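/- Let μ be a discrete positive Borel measure on ℝ whose support contains at least two points, let 𝓛 be an algebraic de Branges space with ∫_ℝ |F| dμ < ∞ for all F ∈ 𝓛 and F ↦ F|_ℝ injective from 𝓛 into L¹(μ), and let g₀ ∈ L^∞(μ) with |g₀| = 1 μ-a.e. be such that the closure of {F|_ℝ : F ∈ 𝓛} in L¹(μ) equals {f ∈ L¹(μ) : ∫_ℝ f·g₀ dμ = 0}. Let 𝔪(z) := sup{|F(z)| : F ∈ 𝓛, ‖F|_ℝ‖_{L¹(μ)} ≤ 1}, and define 𝒦 := { F entire : F|_ℝ ∈ L¹(μ), |F(iy)| = O(𝔪(iy)) as |y| → ∞, and there exists F₀ ∈ 𝓛 \ {0} such that F/F₀ is of bounded type on both ℂ⁺ and ℂ⁻ }. Then the restriction map F ↦ F|_ℝ from 𝒦 to L¹(μ) is injective. -/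

import Mathlib

open Filter MeasureTheory
open scoped ENNReal NNReal

/-- An algebraic de Branges space: a linear space of entire functions, invariant
under division of zeros and under `F ↦ F^#`. -/
def IsAlgebraicDeBranges (L : Submodule ℂ (ℂ → ℂ)) : Prop :=
  (∀ F ∈ L, Differentiable ℂ F) ∧
  (∀ F ∈ L, ∀ w : ℂ, F w = 0 → ∃ G ∈ L, ∀ z : ℂ, z ≠ w → G z = F z / (z - w)) ∧
  (∀ F ∈ L, (fun z => (starRingEnd ℂ) (F ((starRingEnd ℂ) z))) ∈ L)

/-- The norm of the point evaluation at `z`: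
`𝔪(z) = sup {|F(z)| : F ∈ 𝓛, ‖F|_ℝ‖_{L¹(μ)} ≤ 1}`. -/
noncomputable def L1Majorant (μ : Measure ℝ) (L : Submodule ℂ (ℂ → ℂ)) (z : ℂ) : ℝ≥0∞ :=
  ⨆ F : {F : ℂ → ℂ // F ∈ L ∧ (∫⁻ x : ℝ, (‖F (x : ℂ)‖₊ : ℝ≥0∞) ∂μ) ≤ 1},
    (‖F.1 z‖₊ : ℝ≥0∞)

/-- The open upper half-plane. -/
def UpperHalf : Set ℂ := {z | 0 < z.im}

/-- The open lower half-plane. -/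
def LowerHalf : Set ℂ := {z | z.im < 0}

/-- The (possibly meromorphic) quotient `F/G` is of bounded type on `S`:
`F/G = g₁/g₂` with `g₁, g₂` bounded and holomorphic on `S` and `g₂` not
identically zero; the identity `F/G = g₁/g₂` is expressed as `F·g₂ = G·g₁` on `S`. -/
def BddTypeQuot (S : Set ℂ) (F G : ℂ → ℂ) : Prop :=
  ∃ g₁ g₂ : ℂ → ℂ, DifferentiableOn ℂ g₁ S ∧ DifferentiableOn ℂ g₂ S ∧
    (∃ C : ℝ, ∀ z ∈ S, ‖g₁ z‖ ≤ C) ∧ (∃ C : ℝ, ∀ z ∈ S, ‖g₂ z‖ ≤ C) ∧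
    (¬ ∀ z ∈ S, g₂ z = 0) ∧ (∀ z ∈ S, F z * g₂ z = G z * g₁ z)

/-- `μ` is a discrete measure: it lives on a countable set. -/
def IsDiscreteMeasure (μ : Measure ℝ) : Prop :=
  ∃ s : Set ℝ, s.Countable ∧ μ sᶜ = 0

/-- `x` belongs to the (topological) support of `μ`. -/
def MemSupport (μ : Measure ℝ) (x : ℝ) : Prop :=
  ∀ U ∈ nhds x, μ U ≠ 0

/-- Membership in the space `𝒦`: `F` entire, `F|_ℝ ∈ L¹(μ)`,
`|F(iy)| = O(𝔪(iy))` as `|y| → ∞`, and `F/F₀` of bounded type in both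
half-planes for some `F₀ ∈ 𝓛 \ {0}`. -/
def MemKcal (μ : Measure ℝ) (L : Submodule ℂ (ℂ → ℂ)) (F : ℂ → ℂ) : Prop :=
  Differentiable ℂ F ∧
  (∫⁻ x : ℝ, (‖F (x : ℂ)‖₊ : ℝ≥0∞) ∂μ) < ⊤ ∧
  (∃ C : ℝ≥0, ∀ᶠ (y : ℝ) in (atTop ⊔ atBot : Filter ℝ),
    (‖F ((y : ℂ) * Complex.I)‖₊ : ℝ≥0∞) ≤ C * L1Majorant μ L ((y : ℂ) * Complex.I)) ∧
  ∃ F₀ ∈ L, F₀ ≠ (0 : ℂ → ℂ) ∧ BddTypeQuot UpperHalf F F₀ ∧ BddTypeQuot LowerHalf F F₀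

theorem log_norm_le_circleAverage {f : ℂ → ℂ} {c : ℂ} {R : ℝ} (hR : 0 < R)
    (hf : AnalyticOnNhd ℂ f (Metric.closedBall c R)) (hc : f c ≠ 0) :
    Real.log ‖f c‖ ≤ Real.circleAverage (fun z => Real.log ‖f z‖) c R := by
  have hR' : |R| = R := abs_of_pos hR
  rw [AnalyticOnNhd.circleAverage_log_norm hR.ne' (by rwa [hR']) hc, hR', le_add_iff_nonneg_left]
  refine finsum_nonneg fun u => ?_
  by_cases hu : u ∈ Metric.closedBall c R
  · refine mul_nonneg (by exact_mod_cast MeromorphicOn.AnalyticOnNhd.divisor_nonneg hf u) ?_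
    rcases eq_or_ne u c with rfl | huc
    · simp
    · have h0 : 0 < ‖c - u‖ := norm_pos_iff.mpr (sub_ne_zero.mpr huc.symm)
      refine Real.log_nonneg ?_
      rw [← div_eq_mul_inv, one_le_div h0, ← dist_eq_norm, dist_comm]
      exact hu
  · simp [hu]

theorem posLog_norm_le_circleAverage {f : ℂ → ℂ} {c : ℂ} {R : ℝ} (hR : 0 < R)
    (hf : AnalyticOnNhd ℂ f (Metric.closedBall c R)) :
    Real.posLog ‖f c‖ ≤ Real.circleAverage (fun z => Real.posLog ‖f z‖) c R := by
  have hR' : |R| = R := abs_of_pos hR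
  have hm : MeromorphicOn f (Metric.sphere c |R|) := by
    rw [hR']; exact (hf.mono Metric.sphere_subset_closedBall).meromorphicOn
  by_cases hc : f c = 0
  · simpa [hc] using Real.circleAverage_nonneg_of_nonneg fun z _ => Real.posLog_nonneg
  · rw [Real.posLog_apply]
    refine max_le (Real.circleAverage_nonneg_of_nonneg fun z _ => Real.posLog_nonneg)
      ((log_norm_le_circleAverage hR hf hc).trans ?_)
    exact Real.circleAverage_mono hm.circleIntegrable_log_norm hm.circleIntegrable_posLog_norm
      fun z _ => le_max_right _ _

theorem circleAverage_posLog_norm_le {q a : ℂ → ℂ} {c : ℂ} {R : ℝ} (hR : 0 < R)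
    (hq : AnalyticOnNhd ℂ q (Metric.closedBall c R))
    (ha : AnalyticOnNhd ℂ a (Metric.closedBall c R)) (hc : a c ≠ 0)
    (ha1 : ∀ z ∈ Metric.closedBall c R, ‖a z‖ ≤ 1)
    (hqa : ∀ z ∈ Metric.closedBall c R, ‖q z * a z‖ ≤ 1) :
    Real.circleAverage (fun z => Real.posLog ‖q z‖) c R ≤ -Real.log ‖a c‖ := by
  classical
  have hR' : |R| = R := abs_of_pos hR
  have hmq : MeromorphicOn q (Metric.sphere c |R|) := by
    rw [hR']; exact (hq.mono Metric.sphere_subset_closedBall).meromorphicOn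
  have hma : MeromorphicOn a (Metric.sphere c |R|) := by
    rw [hR']; exact (ha.mono Metric.sphere_subset_closedBall).meromorphicOn
  have hcod : (fun z => Real.posLog ‖q z‖) =ᶠ[codiscreteWithin (Metric.sphere c |R|)]
      (fun z => if a z = 0 then 0 else Real.posLog ‖q z‖) := by
    rw [hR']
    have h := ha.preimage_zero_mem_codiscreteWithin hc (by simp [hR.le])
      ⟨⟨c, by simp [hR.le]⟩, (convex_closedBall c R).isPreconnected⟩
    have := codiscreteWithin_mono Metric.sphere_subset_closedBall h
    filter_upwards [this] with z hz
    have : a z ≠ 0 := by simpa using hz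
    simp [this]
  have hint := hmq.circleIntegrable_posLog_norm.congr_codiscreteWithin hcod
  rw [Real.circleAverage_congr_codiscreteWithin hcod hR.ne']
  have h2 : Real.circleAverage (fun z => if a z = 0 then 0 else Real.posLog ‖q z‖) c R ≤
      Real.circleAverage (fun z => -Real.log ‖a z‖) c R := by
    refine Real.circleAverage_mono hint hma.circleIntegrable_log_norm.neg fun z hz => ?_
    have hz' : z ∈ Metric.closedBall c R := by
      rw [hR'] at hz; exact Metric.sphere_subset_closedBall hz
    by_cases h0 : a z = 0
    · simp [h0]
    · have hp : 0 < ‖a z‖ := norm_pos_iff.mpr h0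
      simp only [h0, if_false]
      rw [Real.posLog_apply, max_le_iff]
      refine ⟨neg_nonneg.mpr (Real.log_nonpos hp.le (ha1 z hz')), ?_⟩
      by_cases hq0 : q z = 0
      · simpa [hq0] using Real.log_nonpos hp.le (ha1 z hz')
      have hq1 : 0 < ‖q z‖ := norm_pos_iff.mpr hq0
      have := Real.log_nonpos (norm_nonneg _) (hqa z hz')
      rw [norm_mul, Real.log_mul hq1.ne' hp.ne'] at this
      linarith
  refine h2.trans ?_
  have h3 := log_norm_le_circleAverage hR ha hc
  have h4 : Real.circleAverage (fun z => -Real.log ‖a z‖) c R =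
      -Real.circleAverage (fun z => Real.log ‖a z‖) c R := by
    simp [Real.circleAverage]
  rw [h4]; linarith

theorem lintegral_polar (f : ℂ → ℝ≥0∞) (hf : Measurable f) :
    ∫⁻ z, f z = ∫⁻ r in Set.Ioi (0:ℝ), ENNReal.ofReal r *
      ∫⁻ θ in Set.Ioo (-Real.pi) Real.pi, f (circleMap 0 r θ) := by
  have hcm : ∀ p : ℝ × ℝ, Complex.polarCoord.symm p = circleMap 0 p.1 p.2 := by
    intro p
    rw [Complex.polarCoord_symm_apply, circleMap_zero, Complex.exp_mul_I]
    push_cast; rfl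
  have hmeas : Measurable fun p : ℝ × ℝ => f (circleMap 0 p.1 p.2) := by
    refine hf.comp ?_
    simp only [circleMap_zero]
    fun_prop
  rw [← Complex.lintegral_comp_polarCoord_symm, polarCoord_target]
  rw [Measure.volume_eq_prod, ← Measure.prod_restrict, lintegral_prod]
  · refine lintegral_congr fun r => ?_
    simp_rw [smul_eq_mul, hcm]
    rw [lintegral_const_mul]
    exact hmeas.comp measurable_prodMk_left
  · simp_rw [smul_eq_mul, hcm]
    exact ((by fun_prop : Measurable fun p : ℝ × ℝ => ENNReal.ofReal p.1).mul hmeas).aemeasurable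

theorem lintegral_circleMap_posLog (f : ℂ → ℂ) {c : ℂ} {r : ℝ}
    (hf : MeromorphicOn f (Metric.sphere c |r|)) :
    ∫⁻ θ in Set.Ioo (-Real.pi) Real.pi, ENNReal.ofReal (Real.posLog ‖f (circleMap c r θ)‖) =
      ENNReal.ofReal (2 * Real.pi * Real.circleAverage (fun z => Real.posLog ‖f z‖) c r) := by
  have hci : CircleIntegrable (fun z => Real.posLog ‖f z‖) c r := hf.circleIntegrable_posLog_norm
  rw [Real.circleAverage_eq_integral_add (-Real.pi), smul_eq_mul,
    mul_inv_cancel_left₀ (by positivity)]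
  rw [intervalIntegral.integral_comp_add_right (fun θ => Real.posLog ‖f (circleMap c r θ)‖)]
  rw [intervalIntegral.integral_of_le (by linarith [Real.pi_pos]),
    ofReal_integral_eq_lintegral_ofReal]
  · rw [show (0:ℝ) + -Real.pi = -Real.pi by ring, show 2 * Real.pi + -Real.pi = Real.pi by ring]
    rw [restrict_Ioo_eq_restrict_Ioc]
  · have hper : Function.Periodic (fun θ => Real.posLog ‖f (circleMap c r θ)‖) (2 * Real.pi) :=
      fun θ => by simp [periodic_circleMap c r θ]
    exact (hper.intervalIntegrable₀ Real.two_pi_pos.ne' hci _ _).1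
  · exact ae_of_all _ fun _ => Real.posLog_nonneg

theorem posLog_norm_le_lintegral_closedBall {f : ℂ → ℂ} {c : ℂ} {ρ : ℝ} (hρ : 0 < ρ)
    (hm : Measurable f) (hf : AnalyticOnNhd ℂ f (Metric.closedBall c ρ)) :
    ENNReal.ofReal (Real.pi * ρ ^ 2 / 2 * Real.posLog ‖f c‖) ≤
      ∫⁻ z in Metric.closedBall c ρ, ENNReal.ofReal (Real.posLog ‖f z‖) := by
  have hg : Measurable fun z => ENNReal.ofReal (Real.posLog ‖f z‖) :=
    (Real.continuous_posLog.measurable.comp hm.norm).ennreal_ofReal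
  rw [← lintegral_indicator measurableSet_closedBall, ← lintegral_add_left_eq_self _ c,
    lintegral_polar _
      (by exact (hg.indicator measurableSet_closedBall).comp (measurable_const_add c))]
  have key : ∀ r ∈ Set.Ioo (ρ / 2) ρ, ENNReal.ofReal (ρ / 2) *
      ENNReal.ofReal (2 * Real.pi * Real.posLog ‖f c‖) ≤ ENNReal.ofReal r *
      ∫⁻ θ in Set.Ioo (-Real.pi) Real.pi, (Metric.closedBall c ρ).indicator
        (fun z => ENNReal.ofReal (Real.posLog ‖f z‖)) (c + circleMap 0 r θ) := by
    intro r hr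
    have hr0 : 0 < r := by linarith [hr.1]
    have hfr := hf.mono (Metric.closedBall_subset_closedBall hr.2.le)
    refine mul_le_mul' (ENNReal.ofReal_le_ofReal hr.1.le) ?_
    have h1 : ∀ θ, (Metric.closedBall c ρ).indicator
        (fun z => ENNReal.ofReal (Real.posLog ‖f z‖)) (c + circleMap 0 r θ) =
        ENNReal.ofReal (Real.posLog ‖f (circleMap c r θ)‖) := by
      intro θ
      have h2 : c + circleMap 0 r θ = circleMap c r θ := by simp [circleMap]
      rw [h2, Set.indicator_of_mem]
      exact Metric.closedBall_subset_closedBall hr.2.le (circleMap_mem_closedBall c hr0.le θ)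
    simp_rw [h1]
    rw [lintegral_circleMap_posLog]
    · refine ENNReal.ofReal_le_ofReal ?_
      have := posLog_norm_le_circleAverage hr0 hfr
      gcongr
    · rw [abs_of_pos hr0]
      exact (hfr.mono Metric.sphere_subset_closedBall).meromorphicOn
  calc ENNReal.ofReal (Real.pi * ρ ^ 2 / 2 * Real.posLog ‖f c‖)
      = ∫⁻ r in Set.Ioo (ρ / 2) ρ, ENNReal.ofReal (ρ / 2) *
          ENNReal.ofReal (2 * Real.pi * Real.posLog ‖f c‖) := by
        rw [setLIntegral_const, Real.volume_Ioo, ← ENNReal.ofReal_mul (by positivity),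
          ← ENNReal.ofReal_mul (mul_nonneg (by positivity)
            (mul_nonneg (by positivity) Real.posLog_nonneg))]
        congr 1; ring
    _ ≤ ∫⁻ r in Set.Ioo (ρ / 2) ρ, ENNReal.ofReal r *
      ∫⁻ θ in Set.Ioo (-Real.pi) Real.pi, (Metric.closedBall c ρ).indicator
        (fun z => ENNReal.ofReal (Real.posLog ‖f z‖)) (c + circleMap 0 r θ) :=
        setLIntegral_mono' measurableSet_Ioo key
    _ ≤ _ := lintegral_mono_set fun r hr => by
        have := hr.1
        simp only [Set.mem_Ioi]; linarith

theorem posLog_norm_le_of_circleAverage_le {f : ℂ → ℂ} {ζ : ℂ} {U : ℝ} (hU : 0 ≤ U)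
    (hm : Measurable f) (hf : ∀ z ≠ 1, AnalyticAt ℂ f z) (hζ : ζ ≠ 1) (hδ : ‖ζ - 1‖ ≤ 1 / 4)
    (hav : ∀ r : ℝ, 0 < r → r ≠ 1 → Real.circleAverage (fun z => Real.posLog ‖f z‖) 0 r ≤ U) :
    Real.posLog ‖f ζ‖ ≤ 128 * U / ‖ζ - 1‖ := by
  set δ := ‖ζ - 1‖ with hδdef
  have hδ0 : 0 < δ := norm_pos_iff.mpr (sub_ne_zero.mpr hζ)
  have hg : Measurable fun z => ENNReal.ofReal (Real.posLog ‖f z‖) :=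
    (Real.continuous_posLog.measurable.comp hm.norm).ennreal_ofReal
  have h1 := posLog_norm_le_lintegral_closedBall (c := ζ) (ρ := δ / 2) (by positivity) hm
    (fun z hz => hf z (by
      rintro rfl
      rw [Metric.mem_closedBall, dist_comm, dist_eq_norm, ← hδdef] at hz
      linarith))
  set T : Set ℂ := {z | 1 - 2 * δ < ‖z‖ ∧ ‖z‖ < 1 + 2 * δ} with hT
  have hTm : MeasurableSet T :=
    (measurableSet_lt measurable_const measurable_norm).inter
      (measurableSet_lt measurable_norm measurable_const)
  have hsub : Metric.closedBall ζ (δ / 2) ⊆ T := by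
    intro z hz
    rw [Metric.mem_closedBall, dist_eq_norm] at hz
    have h3 : ‖z - 1‖ ≤ ‖z - ζ‖ + ‖ζ - 1‖ := norm_sub_le_norm_sub_add_norm_sub z ζ 1
    have h4 : |‖z‖ - ‖(1:ℂ)‖| ≤ ‖z - 1‖ := abs_norm_sub_norm_le z 1
    rw [norm_one, abs_le] at h4
    exact ⟨by linarith, by linarith⟩
  have h2 : ∫⁻ z in T, ENNReal.ofReal (Real.posLog ‖f z‖) ≤
      ENNReal.ofReal (16 * Real.pi * U * δ) := by
    rw [← lintegral_indicator hTm, lintegral_polar _ (hg.indicator hTm)]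
    calc _ ≤ ∫⁻ r in Set.Ioi (0:ℝ), (Set.Ioo (1 - 2 * δ) (1 + 2 * δ)).indicator
          (fun _ => ENNReal.ofReal (4 * Real.pi * U)) r := by
          refine lintegral_mono_ae ?_
          have hne : ∀ᵐ r : ℝ, r ≠ 1 := by simp [ae_iff]
          filter_upwards [ae_restrict_of_ae hne, ae_restrict_mem measurableSet_Ioi] with r hr1 hr0
          have hr0' : 0 < r := hr0
          by_cases hr : r ∈ Set.Ioo (1 - 2 * δ) (1 + 2 * δ)
          · rw [Set.indicator_of_mem hr]
            have h5 : ∫⁻ θ in Set.Ioo (-Real.pi) Real.pi, T.indicator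
                (fun z => ENNReal.ofReal (Real.posLog ‖f z‖)) (circleMap 0 r θ) ≤
                ENNReal.ofReal (2 * Real.pi * U) := by
              calc _ ≤ ∫⁻ θ in Set.Ioo (-Real.pi) Real.pi,
                    ENNReal.ofReal (Real.posLog ‖f (circleMap 0 r θ)‖) :=
                    lintegral_mono fun θ => Set.indicator_le_self T
                      (fun z => ENNReal.ofReal (Real.posLog ‖f z‖)) (circleMap 0 r θ)
                _ = _ := by
                    rw [lintegral_circleMap_posLog]
                    intro z hz
                    refine (hf z ?_).meromorphicAt
                    rintro rfl
                    rw [abs_of_pos hr0'] at hz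
                    simp at hz
                    exact hr1 hz.symm
                _ ≤ _ := by
                    refine ENNReal.ofReal_le_ofReal ?_
                    have := hav r hr0' hr1
                    gcongr
            calc _ ≤ ENNReal.ofReal 2 * ENNReal.ofReal (2 * Real.pi * U) :=
                  mul_le_mul' (ENNReal.ofReal_le_ofReal (by linarith [hr.2])) h5
              _ = _ := by
                  rw [← ENNReal.ofReal_mul (by norm_num)]; congr 1; ring
          · rw [Set.indicator_of_notMem hr]
            have h6 : ∀ θ, T.indicator
                (fun z => ENNReal.ofReal (Real.posLog ‖f z‖)) (circleMap 0 r θ) = 0 := by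
              intro θ
              refine Set.indicator_of_notMem (fun h => hr ?_) _
              simpa [hT, abs_of_pos hr0'] using h
            simp [h6]
      _ ≤ ∫⁻ r : ℝ, (Set.Ioo (1 - 2 * δ) (1 + 2 * δ)).indicator
          (fun _ => ENNReal.ofReal (4 * Real.pi * U)) r := setLIntegral_le_lintegral _ _
      _ = _ := by
          rw [lintegral_indicator measurableSet_Ioo, setLIntegral_const, Real.volume_Ioo,
            ← ENNReal.ofReal_mul (by positivity)]
          congr 1; ring
  have h7 := h1.trans ((lintegral_mono_set hsub).trans h2)
  rw [ENNReal.ofReal_le_ofReal_iff (by positivity)] at h7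
  rw [le_div_iff₀ hδ0]
  have h8 : Real.pi * δ / 8 * (Real.posLog ‖f ζ‖ * δ) ≤ Real.pi * δ / 8 * (128 * U) := by
    nlinarith [h7]
  exact le_of_mul_le_mul_left h8 (by positivity)

theorem posLog_norm_le_of_mul_le_one {Φ A : ℂ → ℂ} {z₀ : ℂ} (hΦ : Differentiable ℂ Φ)
    (hA : DifferentiableOn ℂ A {z | 0 < z.im}) (hz₀ : 0 < z₀.im) (hAz₀ : A z₀ ≠ 0)
    (hA1 : ∀ z : ℂ, 0 < z.im → ‖A z‖ ≤ 1)
    (hΦA : ∀ z : ℂ, 0 < z.im → ‖Φ z * A z‖ ≤ 1)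
    (hΦA' : ∀ z : ℂ, 0 < z.im → ‖Φ ((starRingEnd ℂ) z) * A z‖ ≤ 1)
    {z : ℂ} (hz : 8 * z₀.im ≤ ‖z - (starRingEnd ℂ) z₀‖) :
    Real.posLog ‖Φ z‖ ≤ 64 * (-Real.log ‖A z₀‖ / z₀.im) * ‖z - (starRingEnd ℂ) z₀‖ := by
  set w₀ := (starRingEnd ℂ) z₀ with hw₀
  let φ : ℂ → ℂ := fun ζ => (z₀ - w₀ * ζ) / (1 - ζ)
  have hopen : IsOpen {z : ℂ | 0 < z.im} := isOpen_lt continuous_const Complex.continuous_im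
  have hφa : ∀ ζ ≠ 1, AnalyticAt ℂ φ ζ := fun ζ hζ => by
    have : (1:ℂ) - ζ ≠ 0 := sub_ne_zero.mpr hζ.symm
    fun_prop (disch := assumption)
  have hφm : Measurable φ := by fun_prop
  have hφim : ∀ ζ : ℂ, ‖ζ‖ < 1 → 0 < (φ ζ).im := by
    intro ζ hζ
    have h1 : (1:ℂ) - ζ ≠ 0 := sub_ne_zero.mpr (by rintro rfl; simp at hζ)
    have h2 : (φ ζ).im = z₀.im * (1 - Complex.normSq ζ) / Complex.normSq (1 - ζ) := by
      simp only [φ, Complex.div_im, hw₀, Complex.normSq_apply]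
      simp
      ring
    rw [h2]
    have h3 : Complex.normSq ζ < 1 := by
      rw [Complex.normSq_eq_norm_sq]; nlinarith [norm_nonneg ζ]
    have h4 := Complex.normSq_pos.mpr h1
    have : 0 < 1 - Complex.normSq ζ := by linarith
    positivity
  have hφ0 : φ 0 = z₀ := by simp [φ]
  have hana : ∀ {r : ℝ} {g : ℂ → ℂ}, r < 1 → DifferentiableOn ℂ g {z | 0 < z.im} →
      AnalyticOnNhd ℂ (g ∘ φ) (Metric.closedBall 0 r) := by
    intro r g hr hg ζ hζ
    have hζ1 : ‖ζ‖ < 1 := by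
      rw [mem_closedBall_zero_iff] at hζ; linarith
    have hne : ζ ≠ 1 := by rintro rfl; simp at hζ1
    exact ((hg.analyticOnNhd hopen) _ (hφim ζ hζ1)).comp (hφa ζ hne)
  have hdisc : ∀ {q : ℂ → ℂ}, Differentiable ℂ q → (∀ z : ℂ, 0 < z.im → ‖q z * A z‖ ≤ 1) →
      ∀ r : ℝ, 0 < r → r < 1 →
      Real.circleAverage (fun z => Real.posLog ‖(q ∘ φ) z‖) 0 r ≤ -Real.log ‖A z₀‖ := by
    intro q hq hqA r hr0 hr1
    have h := circleAverage_posLog_norm_le (q := q ∘ φ) (a := A ∘ φ) (c := 0) hr0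
      (hana hr1 hq.differentiableOn) (hana hr1 hA) (by simpa [hφ0] using hAz₀)
      (fun ζ hζ => hA1 _ (hφim ζ (by rw [mem_closedBall_zero_iff] at hζ; linarith)))
      (fun ζ hζ => hqA _ (hφim ζ (by rw [mem_closedBall_zero_iff] at hζ; linarith)))
    simpa [hφ0] using h
  have hrefl : Differentiable ℂ (fun z => (starRingEnd ℂ) (Φ ((starRingEnd ℂ) z))) :=
    fun z => by
    have := (hΦ ((starRingEnd ℂ) z)).conj_conj
    simpa [Function.comp_def] using this
  have hzw : z - w₀ ≠ 0 := by
    intro h; rw [h, norm_zero] at hz; linarith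
  have h0w : z₀ - w₀ = 2 * z₀.im * Complex.I := by
    rw [hw₀, Complex.sub_conj]; push_cast; ring
  have h0w' : ‖z₀ - w₀‖ = 2 * z₀.im := by
    rw [h0w]; simp [abs_of_pos hz₀]
  have h0w0 : z₀ - w₀ ≠ 0 := by
    rw [← norm_pos_iff, h0w']; linarith
  set ζ : ℂ := (z - z₀) / (z - w₀) with hζ
  have h1ζ : 1 - ζ = (z₀ - w₀) / (z - w₀) := by rw [hζ]; field_simp; ring
  have hφζ : φ ζ = z := by
    simp only [φ]
    rw [h1ζ, hζ]
    field_simp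
    ring
  have hnorm : ‖ζ - 1‖ = 2 * z₀.im / ‖z - w₀‖ := by
    rw [norm_sub_rev, h1ζ, norm_div, h0w']
  have hzpos : 0 < ‖z - w₀‖ := norm_pos_iff.mpr hzw
  have hlog : 0 ≤ -Real.log ‖A z₀‖ :=
    neg_nonneg.mpr (Real.log_nonpos (norm_nonneg _) (hA1 _ hz₀))
  have h := posLog_norm_le_of_circleAverage_le (f := Φ ∘ φ) (ζ := ζ) hlog
    (hΦ.continuous.measurable.comp hφm)
    (fun ζ hζ => (hΦ.analyticAt _).comp (hφa ζ hζ))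
    (by
      intro h
      rw [h, sub_self] at h1ζ
      exact div_ne_zero h0w0 hzw h1ζ.symm)
    (by
      rw [hnorm, div_le_iff₀ hzpos]; linarith)
    (by
      intro r hr0 hr1
      rcases lt_or_gt_of_ne hr1 with hr | hr
      · exact hdisc hΦ hΦA r hr0 hr
      · have h2 := hdisc hrefl (fun z hz => by simpa using hΦA' z hz) r⁻¹ (by positivity)
          (inv_lt_one_of_one_lt₀ hr)
        refine le_trans (le_of_eq ?_) h2
        simp only [Real.circleAverage]
        congr 1
        refine intervalIntegral.integral_congr fun θ _ => ?_
        simp only [Function.comp, RCLike.norm_conj]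
        congr 3
        have hr0' : (r:ℂ) ≠ 0 := by exact_mod_cast hr0.ne'
        have hn1 : circleMap 0 r θ ≠ 1 := by
          intro h
          have := congrArg norm h
          rw [norm_circleMap_zero, abs_of_pos hr0] at this
          simp at this; exact hr1 this
        have hn0 : circleMap 0 r θ ≠ 0 := by simpa using hr0.ne'
        have h3 : (starRingEnd ℂ) (circleMap 0 r⁻¹ θ) = (circleMap 0 r θ)⁻¹ := by
          rw [conj_circleMap_zero, circleMap_zero_inv]
        simp only [φ, map_div₀, map_sub, map_mul, map_one, h3, hw₀, Complex.conj_conj]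
        rw [← hw₀]
        have h4 : 1 - circleMap 0 r θ ≠ 0 := sub_ne_zero.mpr hn1.symm
        have h5 : 1 - (circleMap 0 r θ)⁻¹ ≠ 0 :=
          sub_ne_zero.mpr (by simpa [eq_comm] using hn1)
        rw [div_eq_div_iff h4 h5]
        field_simp
        ring)
  simp only [Function.comp, hφζ] at h
  refine h.trans (le_of_eq ?_)
  rw [hnorm]
  field_simp
  ring

theorem norm_le_of_bounded_on_imaginary_axis_of_re_nonneg {Φ : ℂ → ℂ} {K : ℝ}
    (hΦ : Differentiable ℂ Φ)
    (hgr : ∀ ε : ℝ, 0 < ε → ∃ C : ℝ, ∀ z, ‖Φ z‖ ≤ C * Real.exp (ε * ‖z‖))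
    (hK : ∀ y : ℝ, ‖Φ (y * Complex.I)‖ ≤ K) {z : ℂ} (hz : 0 ≤ z.re) : ‖Φ z‖ ≤ K := by
  have key : ∀ ε : ℝ, 0 < ε → ‖Φ z‖ ≤ K * Real.exp (ε * z.re) := by
    intro ε hε
    have hnorm : ∀ w : ℂ, ‖Φ w * Complex.exp (-(ε * w))‖ = ‖Φ w‖ * Real.exp (-(ε * w.re)) := by
      intro w; rw [norm_mul, Complex.norm_exp]; simp
    obtain ⟨C, hC⟩ := hgr (ε / 2) (by positivity)
    have hC0 : 0 ≤ C := by
      have := (norm_nonneg _).trans (hC 0); simpa using this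
    have h := PhragmenLindelof.right_half_plane_of_tendsto_zero_on_real
      (f := fun w => Φ w * Complex.exp (-(ε * w))) (C := K) (z := z)
      (Differentiable.diffContOnCl (by fun_prop)) ⟨1, by norm_num, ε / 2, ?_⟩ ?_ ?_ hz
    · rw [hnorm, Real.exp_neg, ← div_eq_mul_inv, div_le_iff₀ (Real.exp_pos _)] at h
      exact h
    · refine Asymptotics.IsBigO.of_bound C ?_
      filter_upwards [mem_inf_of_right (mem_principal_self _)] with w hw
      have hw' : 0 < w.re := hw
      rw [hnorm, Real.norm_eq_abs, Real.abs_exp, Real.rpow_one]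
      calc ‖Φ w‖ * Real.exp (-(ε * w.re)) ≤ ‖Φ w‖ * 1 := by
            gcongr; rw [Real.exp_le_one_iff]; nlinarith
        _ ≤ _ := by rw [mul_one]; exact hC w
    · rw [tendsto_zero_iff_norm_tendsto_zero]
      have hlim : Tendsto (fun x : ℝ => C * Real.exp (-(ε / 2 * x))) atTop (nhds 0) := by
        have h1 : Tendsto (fun x : ℝ => ε / 2 * x) atTop atTop :=
          tendsto_id.const_mul_atTop (by positivity)
        have := (Real.tendsto_exp_neg_atTop_nhds_zero.comp h1).const_mul C
        simpa using this
      refine squeeze_zero' (Eventually.of_forall fun _ => norm_nonneg _) ?_ hlim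
      filter_upwards [eventually_ge_atTop 0] with x hx
      rw [hnorm]
      have := hC x
      rw [Complex.norm_real, Real.norm_eq_abs, abs_of_nonneg hx] at this
      calc ‖Φ x‖ * Real.exp (-(ε * (x : ℂ).re))
          ≤ C * Real.exp (ε / 2 * x) * Real.exp (-(ε * x)) := by
            rw [Complex.ofReal_re]; gcongr
        _ = _ := by rw [mul_assoc, ← Real.exp_add]; congr 2; ring
    · intro x
      rw [hnorm]
      simpa using hK x
  have hlim : Tendsto (fun ε : ℝ => K * Real.exp (ε * z.re)) (nhdsWithin 0 (Set.Ioi 0))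
      (nhds K) := by
    refine Tendsto.mono_left ?_ nhdsWithin_le_nhds
    exact Continuous.tendsto' (by fun_prop) _ _ (by simp)
  exact ge_of_tendsto hlim (by filter_upwards [self_mem_nhdsWithin] with ε hε using key ε hε)

theorem apply_eq_of_bounded_on_imaginary_axis {Φ : ℂ → ℂ} {K : ℝ} (hΦ : Differentiable ℂ Φ)
    (hgr : ∀ ε : ℝ, 0 < ε → ∃ C : ℝ, ∀ z, ‖Φ z‖ ≤ C * Real.exp (ε * ‖z‖))
    (hK : ∀ y : ℝ, ‖Φ (y * Complex.I)‖ ≤ K) (z w : ℂ) : Φ z = Φ w := by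
  refine hΦ.apply_eq_apply_of_bounded (isBounded_iff_forall_norm_le.mpr ⟨K, ?_⟩) z w
  rintro _ ⟨u, rfl⟩
  rcases le_total 0 u.re with hu | hu
  · exact norm_le_of_bounded_on_imaginary_axis_of_re_nonneg hΦ hgr hK hu
  · have := norm_le_of_bounded_on_imaginary_axis_of_re_nonneg (Φ := fun z => Φ (-z)) (K := K)
      (z := -u) (by fun_prop)
      (fun ε hε => by
        obtain ⟨C, hC⟩ := hgr ε hε
        exact ⟨C, fun z => by simpa using hC (-z)⟩)
      (fun y => by simpa using hK (-y)) (by simpa using hu)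
    simpa using this

theorem norm_le_of_exp_growth_of_bounded_on_imaginary_ray {B : ℂ → ℂ} {M τ K : ℝ}
    (hB : DifferentiableOn ℂ B {z | 0 < z.im})
    (hM : ∀ z : ℂ, 0 < z.im → ‖B z‖ ≤ M * Real.exp (τ * z.im))
    (hK : ∀ y : ℝ, 0 < y → ‖B (y * Complex.I)‖ ≤ K) (hM0 : 0 ≤ M) (hτ : 0 ≤ τ)
    {z : ℂ} (hz : 0 < z.im) : ‖B z‖ ≤ M := by
  have key : ∀ η : ℝ, 0 < η → η < z.im → ‖B z‖ ≤ M * Real.exp (τ * η) := by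
    intro η hη hηz
    let g : ℂ → ℂ := fun w => B (Complex.I * w + η * Complex.I)
    have him : ∀ w : ℂ, (Complex.I * w + η * Complex.I).im = w.re + η := fun w => by simp
    have h := PhragmenLindelof.right_half_plane_of_bounded_on_real (f := g)
      (C := M * Real.exp (τ * η)) (z := -Complex.I * (z - η * Complex.I))
      ?_ ⟨1, by norm_num, τ, ?_⟩ ?_ ?_ ?_
    · have h2 : Complex.I * (-Complex.I * (z - η * Complex.I)) + η * Complex.I = z := by
        linear_combination (-(z - η * Complex.I)) * Complex.I_mul_I
      simp only [g] at h
      rwa [h2] at h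
    · refine DifferentiableOn.diffContOnCl ?_
      have hcl : closure {w : ℂ | 0 < w.re} ⊆ {w : ℂ | 0 ≤ w.re} :=
        closure_minimal (fun w (hw : 0 < w.re) => show 0 ≤ w.re from hw.le)
          (isClosed_le continuous_const Complex.continuous_re)
      refine DifferentiableOn.mono (DifferentiableOn.comp hB (by fun_prop) ?_) hcl
      intro w hw
      have hw' : 0 ≤ w.re := hw
      simp only [Set.mem_ofPred_eq, him]; linarith
    · refine Asymptotics.IsBigO.of_bound (M * Real.exp (τ * η)) ?_
      filter_upwards [mem_inf_of_right (mem_principal_self _)] with w hw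
      have hw' : 0 < w.re := hw
      refine (hM _ (by rw [him]; linarith)).trans ?_
      rw [him, Real.norm_eq_abs, Real.abs_exp, Real.rpow_one, mul_assoc, ← Real.exp_add]
      have := Complex.re_le_norm w
      gcongr
      nlinarith
    · refine isBoundedUnder_of_eventually_le (a := K) ?_
      filter_upwards [eventually_ge_atTop 0] with x hx
      have h := hK (x + η) (by linarith)
      have h1 : Complex.I * x + η * Complex.I = ((x + η : ℝ) : ℂ) * Complex.I := by
        push_cast; ring
      rw [← h1] at h
      exact h
    · intro x
      have := hM (Complex.I * (x * Complex.I) + η * Complex.I) (by rw [him]; simpa using hη)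
      rw [him] at this
      simpa [g] using this
    · simp; linarith
  have hlim : Tendsto (fun η : ℝ => M * Real.exp (τ * η)) (nhdsWithin 0 (Set.Ioi 0)) (nhds M) := by
    refine Tendsto.mono_left ?_ nhdsWithin_le_nhds
    exact Continuous.tendsto' (by fun_prop) _ _ (by simp)
  exact ge_of_tendsto hlim (by
    filter_upwards [Ioo_mem_nhdsGT hz] with η hη using key η hη.1 hη.2)

theorem exists_maximal_exp_decay {A : ℂ → ℂ} {M : ℝ} (hM : ∀ z : ℂ, 0 < z.im → ‖A z‖ ≤ M)
    (hA : ¬ ∀ z : ℂ, 0 < z.im → A z = 0) :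
    ∃ τ : ℝ, 0 ≤ τ ∧ (∀ z : ℂ, 0 < z.im → ‖A z‖ ≤ M * Real.exp (-(τ * z.im))) ∧
      ∀ ε : ℝ, 0 < ε → ∃ z : ℂ, 0 < z.im ∧ M * Real.exp (-((τ + ε) * z.im)) < ‖A z‖ := by
  push Not at hA
  obtain ⟨z₁, hz₁, hA₁⟩ := hA
  have hA₁' := norm_pos_iff.mpr hA₁
  have hM0 : 0 < M := hA₁'.trans_le (hM _ hz₁)
  set T : Set ℝ := {t | 0 ≤ t ∧ ∀ z : ℂ, 0 < z.im → ‖A z‖ ≤ M * Real.exp (-(t * z.im))} with hT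
  have hTne : T.Nonempty := ⟨0, le_rfl, by simpa using hM⟩
  have hTb : BddAbove T := by
    refine ⟨Real.log (M / ‖A z₁‖) / z₁.im, fun t ht => ?_⟩
    rw [le_div_iff₀ hz₁, Real.le_log_iff_exp_le (by positivity), le_div_iff₀ hA₁']
    have := ht.2 z₁ hz₁
    rwa [Real.exp_neg, ← div_eq_mul_inv, le_div_iff₀ (Real.exp_pos _), mul_comm] at this
  have hTc : IsClosed T := by
    simp only [hT, Set.ofPred_and, Set.ofPred_forall]
    refine (isClosed_le continuous_const continuous_id).inter
      (isClosed_iInter fun z => isClosed_iInter fun _ => isClosed_le continuous_const (by fun_prop))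
  have hmem := hTc.csSup_mem hTne hTb
  refine ⟨sSup T, hmem.1, hmem.2, fun ε hε => ?_⟩
  by_contra! hcon
  have := le_csSup hTb (show sSup T + ε ∈ T from ⟨add_nonneg hmem.1 hε.le, hcon⟩)
  linarith

theorem exp_type_zero_of_bounded_type {Φ A : ℂ → ℂ} {M M' K : ℝ} (hΦ : Differentiable ℂ Φ)
    (hA : DifferentiableOn ℂ A {z | 0 < z.im}) (hA0 : ¬ ∀ z : ℂ, 0 < z.im → A z = 0)
    (hAM : ∀ z : ℂ, 0 < z.im → ‖A z‖ ≤ M)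
    (hΦA : ∀ z : ℂ, 0 < z.im → ‖Φ z * A z‖ ≤ M')
    (hΦA' : ∀ z : ℂ, 0 < z.im → ‖Φ ((starRingEnd ℂ) z) * A z‖ ≤ M')
    (hK : ∀ y : ℝ, ‖Φ (y * Complex.I)‖ ≤ K) {ε : ℝ} (hε : 0 < ε) :
    ∃ C : ℝ, ∀ z, ‖Φ z‖ ≤ C * Real.exp (ε * ‖z‖) := by
  obtain ⟨τ, hτ, hτA, hτmax⟩ := exists_maximal_exp_decay hAM hA0
  have hM0 : 0 < M := by
    push Not at hA0
    obtain ⟨z₁, hz₁, hA₁⟩ := hA0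
    exact (norm_pos_iff.mpr hA₁).trans_le (hAM _ hz₁)
  have hM'0 : 0 ≤ M' := (norm_nonneg _).trans (hΦA Complex.I (by simp))
  let A₁ : ℂ → ℂ := fun z => A z * Complex.exp (-(Complex.I * τ * z)) / M
  have hA₁norm : ∀ z, ‖A₁ z‖ = ‖A z‖ * Real.exp (τ * z.im) / M := by
    intro z
    simp only [A₁]
    rw [norm_div, norm_mul, Complex.norm_exp, Complex.norm_real, Real.norm_of_nonneg hM0.le]
    simp
  have hA₁d : DifferentiableOn ℂ A₁ {z | 0 < z.im} :=
    (hA.mul (by fun_prop)).div_const _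
  have hA₁1 : ∀ z : ℂ, 0 < z.im → ‖A₁ z‖ ≤ 1 := by
    intro z hz
    have := hτA z hz
    rw [Real.exp_neg, ← div_eq_mul_inv, le_div_iff₀ (Real.exp_pos _)] at this
    rwa [hA₁norm, div_le_one hM0]
  set N : ℝ := M' / M + 1 with hN
  have hN0 : 0 < N := by positivity
  have hbd : ∀ q : ℂ → ℂ, Differentiable ℂ q → (∀ z : ℂ, 0 < z.im → ‖q z * A z‖ ≤ M') →
      (∀ y : ℝ, ‖q (y * Complex.I)‖ ≤ K) → ∀ z : ℂ, 0 < z.im → ‖q z * A₁ z‖ ≤ N := by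
    intro q hq hqA hqK z hz
    have hK0 : 0 ≤ K := (norm_nonneg _).trans (hqK 0)
    refine (norm_le_of_exp_growth_of_bounded_on_imaginary_ray (B := fun z => q z * A₁ z)
      (M := M' / M) (τ := τ) (K := K) (hq.differentiableOn.mul hA₁d) ?_ ?_ (by positivity) hτ
      hz).trans (by linarith)
    · intro w hw
      have h := hqA w hw
      rw [norm_mul] at h
      rw [norm_mul, hA₁norm]
      calc ‖q w‖ * (‖A w‖ * Real.exp (τ * w.im) / M)
          = ‖q w‖ * ‖A w‖ / M * Real.exp (τ * w.im) := by ring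
        _ ≤ _ := by gcongr
    · intro y hy
      rw [norm_mul]
      have h1 := hA₁1 (y * Complex.I) (by simpa using hy)
      calc _ ≤ K * 1 := mul_le_mul (hqK y) h1 (norm_nonneg _) hK0
        _ = K := mul_one K
  have hb1 := hbd Φ hΦ hΦA hK
  have hb2 := hbd (fun z => (starRingEnd ℂ) (Φ ((starRingEnd ℂ) z)))
    (fun z => by
      have := (hΦ ((starRingEnd ℂ) z)).conj_conj
      simpa [Function.comp_def] using this)
    (fun z hz => by simpa using hΦA' z hz)
    (fun y => by simpa using hK (-y))
  obtain ⟨z₀, hz₀, hz₀A⟩ := hτmax (ε / 64) (by positivity)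
  have hlow : Real.exp (-(ε / 64 * z₀.im)) < ‖A₁ z₀‖ := by
    rw [hA₁norm, lt_div_iff₀ hM0]
    calc Real.exp (-(ε / 64 * z₀.im)) * M
        = M * Real.exp (-((τ + ε / 64) * z₀.im)) * Real.exp (τ * z₀.im) := by
          rw [mul_assoc, ← Real.exp_add, mul_comm]; congr 2; ring
      _ < _ := by gcongr
  have hA₁pos : 0 < ‖A₁ z₀‖ := (Real.exp_pos _).trans hlow
  have hlog : -Real.log ‖A₁ z₀‖ / z₀.im ≤ ε / 64 := by
    rw [div_le_iff₀ hz₀]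
    have := (Real.lt_log_iff_exp_lt hA₁pos).mpr hlow
    linarith
  have hfar : ∀ z : ℂ, 8 * z₀.im ≤ ‖z - (starRingEnd ℂ) z₀‖ →
      ‖Φ z‖ ≤ N * Real.exp (ε * ‖z₀‖) * Real.exp (ε * ‖z‖) := by
    intro z hz
    have h := posLog_norm_le_of_mul_le_one (Φ := fun z => Φ z / N) (A := A₁) (hΦ.div_const _)
      hA₁d hz₀ (norm_pos_iff.mp hA₁pos) hA₁1 ?_ ?_ hz
    · have h1 : Real.posLog ‖Φ z / N‖ ≤ ε * (‖z‖ + ‖z₀‖) := by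
        refine h.trans ?_
        have h2 : ‖z - (starRingEnd ℂ) z₀‖ ≤ ‖z‖ + ‖z₀‖ := by
          refine (norm_sub_le _ _).trans (by rw [RCLike.norm_conj])
        calc _ ≤ 64 * (ε / 64) * (‖z‖ + ‖z₀‖) := by gcongr
          _ = _ := by ring
      have h3 : ‖Φ z / N‖ ≤ Real.exp (ε * (‖z‖ + ‖z₀‖)) := by
        have h4 : Real.log ‖Φ z / N‖ ≤ ε * (‖z‖ + ‖z₀‖) := (le_max_right _ _).trans h1
        exact (Real.le_exp_log _).trans (Real.exp_le_exp.mpr h4)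
      rw [norm_div, Complex.norm_real, Real.norm_of_nonneg hN0.le, div_le_iff₀ hN0] at h3
      refine h3.trans (le_of_eq ?_)
      rw [mul_assoc N, ← Real.exp_add, mul_comm]
      congr 2; ring
    · intro w hw
      rw [div_mul_eq_mul_div, norm_div, Complex.norm_real, Real.norm_of_nonneg hN0.le,
        div_le_one hN0]
      exact hb1 w hw
    · intro w hw
      rw [div_mul_eq_mul_div, norm_div, Complex.norm_real, Real.norm_of_nonneg hN0.le,
        div_le_one hN0]
      simpa using hb2 w hw
  obtain ⟨C₁, hC₁⟩ :=
    (isCompact_closedBall ((starRingEnd ℂ) z₀) (8 * z₀.im)).exists_bound_of_continuousOn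
      hΦ.continuous.continuousOn
  refine ⟨max (N * Real.exp (ε * ‖z₀‖)) C₁, fun z => ?_⟩
  rcases le_total (8 * z₀.im) ‖z - (starRingEnd ℂ) z₀‖ with hz | hz
  · exact (hfar z hz).trans (by gcongr; exact le_max_left _ _)
  · have h1 := hC₁ z (by rwa [Metric.mem_closedBall, dist_eq_norm])
    have h2 : 0 ≤ C₁ := (norm_nonneg _).trans h1
    calc ‖Φ z‖ ≤ C₁ * 1 := by rwa [mul_one]
      _ ≤ _ := by
        gcongr
        · exact le_max_right _ _
        · exact Real.one_le_exp (by positivity)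

theorem differentiableAt_integral_of_locally_dominated {α : Type*} [MeasurableSpace α]
    {μ : Measure α} {k : ℂ → α → ℂ} {w₀ : ℂ} {r : ℝ} {bound : α → ℝ} (hr : 0 < r)
    (hm : ∀ w ∈ Metric.ball w₀ r, AEStronglyMeasurable (k w) μ)
    (hd : ∀ᵐ t ∂μ, DifferentiableOn ℂ (fun w => k w t) (Metric.ball w₀ r))
    (hb : ∀ᵐ t ∂μ, ∀ w ∈ Metric.ball w₀ r, ‖k w t‖ ≤ bound t) (hi : Integrable bound μ) :
    DifferentiableAt ℂ (fun w => ∫ t, k w t ∂μ) w₀ := by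
  have hw₀ : w₀ ∈ Metric.ball w₀ r := Metric.mem_ball_self hr
  have hderiv : ∀ᵐ t ∂μ, ∀ w ∈ Metric.ball w₀ r,
      HasDerivAt (fun w => k w t) (deriv (fun w => k w t) w) w := by
    filter_upwards [hd] with t ht w hw
    exact (ht.differentiableAt (Metric.isOpen_ball.mem_nhds hw)).hasDerivAt
  refine (hasDerivAt_integral_of_dominated_loc_of_deriv_le
    (F' := fun w t => deriv (fun w => k w t) w) (s := Metric.ball w₀ (r / 2))
    (bound := fun t => bound t / (r / 4)) (Metric.ball_mem_nhds _ (by positivity))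
    ?_ ?_ ?_ ?_ (hi.div_const _) ?_).2.differentiableAt
  · filter_upwards [Metric.ball_mem_nhds w₀ hr] with w hw using hm w hw
  · exact hi.mono' (hm w₀ hw₀) (hb.mono fun t ht => ht w₀ hw₀)
  · let u : ℕ → ℂ := fun n => w₀ + ((r / (n + 2) : ℝ) : ℂ)
    have hpos : ∀ n : ℕ, 0 < r / ((n : ℝ) + 2) := fun n => by positivity
    have hu : ∀ n, u n ∈ Metric.ball w₀ r := fun n => by
      rw [Metric.mem_ball, dist_eq_norm]
      simp only [u, add_sub_cancel_left]
      rw [Complex.norm_real, Real.norm_of_nonneg (hpos n).le, div_lt_iff₀ (by positivity)]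
      nlinarith [(Nat.cast_nonneg n : (0 : ℝ) ≤ n)]
    have hune : ∀ n, u n ≠ w₀ := fun n => by
      simp only [u, ne_eq, add_eq_left]
      exact_mod_cast (hpos n).ne'
    have hlim : Tendsto u atTop (nhdsWithin w₀ {w₀}ᶜ) := by
      refine tendsto_nhdsWithin_iff.mpr ⟨?_, Eventually.of_forall hune⟩
      have h1 : Tendsto (fun n : ℕ => r / ((n : ℝ) + 2)) atTop (nhds 0) :=
        tendsto_const_nhds.div_atTop
          (tendsto_atTop_add_const_right _ _ tendsto_natCast_atTop_atTop)
      have h2 := (Complex.continuous_ofReal.tendsto 0).comp h1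
      simpa [u] using h2.const_add w₀
    refine aestronglyMeasurable_of_tendsto_ae atTop
      (f := fun n t => slope (fun w => k w t) w₀ (u n)) (fun n => ?_) ?_
    · simp only [slope_def_module]
      exact ((hm _ (hu n)).sub (hm _ hw₀)).const_smul (u n - w₀)⁻¹
    · filter_upwards [hderiv] with t ht
      exact (ht w₀ hw₀).tendsto_slope.comp hlim
  · filter_upwards [hd, hb] with t htd htb w hw
    have hsub : Metric.closedBall w (r / 4) ⊆ Metric.ball w₀ r := fun v hv => by
      rw [Metric.mem_closedBall] at hv
      rw [Metric.mem_ball] at hw ⊢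
      linarith [dist_triangle v w w₀]
    exact Complex.norm_deriv_le_of_forall_mem_sphere_norm_le (by positivity)
      ((htd.mono hsub).diffContOnCl_ball subset_rfl)
      fun v hv => htb v (hsub (Metric.sphere_subset_closedBall hv))
  · filter_upwards [hderiv] with t ht w hw
    exact ht w (Metric.ball_subset_ball (by linarith) hw)

/-- The Cauchy transform of the complex measure `f μ`. -/
noncomputable def cauchyTransform (μ : Measure ℝ) (f : ℝ → ℂ) (w : ℂ) : ℂ :=
  ∫ t, f t / ((t : ℂ) - w) ∂μ

theorem abs_im_le_norm_ofReal_sub (t : ℝ) (w : ℂ) : |w.im| ≤ ‖(t : ℂ) - w‖ := by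
  simpa using Complex.abs_im_le_norm ((t : ℂ) - w)

theorem ofReal_sub_ne_zero {w : ℂ} (hw : w.im ≠ 0) (t : ℝ) : (t : ℂ) - w ≠ 0 :=
  norm_pos_iff.mp ((abs_pos.mpr hw).trans_le (abs_im_le_norm_ofReal_sub t w))

theorem norm_div_ofReal_sub_le {w : ℂ} (hw : w.im ≠ 0) (t : ℝ) (c : ℂ) :
    ‖c / ((t : ℂ) - w)‖ ≤ ‖c‖ / |w.im| := by
  rw [norm_div]
  have := abs_pos.mpr hw
  gcongr
  exact abs_im_le_norm_ofReal_sub t w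

theorem aestronglyMeasurable_div_ofReal_sub {μ : Measure ℝ} {f : ℝ → ℂ}
    (hf : AEStronglyMeasurable f μ) (w : ℂ) :
    AEStronglyMeasurable (fun t => f t / ((t : ℂ) - w)) μ := by
  simp only [div_eq_mul_inv]
  refine hf.mul (Measurable.aestronglyMeasurable ?_)
  fun_prop

theorem integrable_div_ofReal_sub {μ : Measure ℝ} {f : ℝ → ℂ} (hf : Integrable f μ) {w : ℂ}
    (hw : w.im ≠ 0) : Integrable (fun t => f t / ((t : ℂ) - w)) μ :=
  (hf.norm.div_const |w.im|).mono' (aestronglyMeasurable_div_ofReal_sub hf.1 w)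
    (Eventually.of_forall fun t => norm_div_ofReal_sub_le hw t (f t))

theorem norm_cauchyTransform_le {μ : Measure ℝ} {f : ℝ → ℂ} (hf : Integrable f μ) {w : ℂ}
    (hw : w.im ≠ 0) : ‖cauchyTransform μ f w‖ ≤ (∫ t, ‖f t‖ ∂μ) / |w.im| := by
  rw [← integral_div]
  exact norm_integral_le_of_norm_le (hf.norm.div_const _)
    (Eventually.of_forall fun t => norm_div_ofReal_sub_le hw t (f t))

theorem differentiableAt_cauchyTransform {μ : Measure ℝ} {f : ℝ → ℂ} (hf : Integrable f μ) {w : ℂ}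
    (hw : w.im ≠ 0) : DifferentiableAt ℂ (cauchyTransform μ f) w := by
  have hpos := abs_pos.mpr hw
  have him : ∀ v ∈ Metric.ball w (|w.im| / 2), |w.im| / 2 ≤ |v.im| := fun v hv => by
    rw [Metric.mem_ball, dist_eq_norm] at hv
    have h1 := (Complex.abs_im_le_norm (v - w)).trans hv.le
    rw [Complex.sub_im] at h1
    have h2 := abs_sub_abs_le_abs_sub w.im v.im
    rw [abs_sub_comm] at h2
    linarith
  have hne : ∀ v ∈ Metric.ball w (|w.im| / 2), v.im ≠ 0 := fun v hv =>
    abs_pos.mp ((half_pos hpos).trans_le (him v hv))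
  refine differentiableAt_integral_of_locally_dominated (half_pos hpos)
    (bound := fun t => ‖f t‖ / (|w.im| / 2))
    (fun v _ => aestronglyMeasurable_div_ofReal_sub hf.1 v)
    (Eventually.of_forall fun t => ?_) (Eventually.of_forall fun t v hv => ?_)
    (hf.norm.div_const _)
  · exact (differentiableOn_const _).div (by fun_prop) fun v hv => ofReal_sub_ne_zero (hne v hv) t
  · refine (norm_div_ofReal_sub_le (hne v hv) t _).trans ?_
    gcongr
    exact him v hv

theorem cauchyTransform_conj (μ : Measure ℝ) (f : ℝ → ℂ) (w : ℂ) :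
    cauchyTransform μ (fun t => (starRingEnd ℂ) (f t)) w =
      (starRingEnd ℂ) (cauchyTransform μ f ((starRingEnd ℂ) w)) := by
  unfold cauchyTransform
  rw [← integral_conj]
  simp

theorem im_cauchyTransform_nonneg {μ : Measure ℝ} {p : ℝ → ℝ} (hp : ∀ t, 0 ≤ p t)
    (hpi : Integrable p μ) {w : ℂ} (hw : 0 < w.im) :
    0 ≤ (cauchyTransform μ (fun t => (p t : ℂ)) w).im := by
  have h := integral_im (𝕜 := ℂ) (integrable_div_ofReal_sub hpi.ofReal hw.ne')
  refine le_of_le_of_eq (integral_nonneg fun t => ?_) h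
  have : RCLike.im ((p t : ℂ) / ((t : ℂ) - w)) = p t * w.im / Complex.normSq ((t : ℂ) - w) := by
    simp [Complex.div_im, neg_div]
  rw [Pi.zero_apply]
  refine le_of_le_of_eq ?_ this.symm
  exact div_nonneg (mul_nonneg (hp t) hw.le) (Complex.normSq_nonneg _)

/-- `C` is a quotient of bounded holomorphic functions on the upper half-plane, with a zero-free
denominator. -/
def HasZeroFreeDenominator (C : ℂ → ℂ) : Prop :=
  ∃ d : ℂ → ℂ, DifferentiableOn ℂ d {z | 0 < z.im} ∧ (∀ z : ℂ, 0 < z.im → d z ≠ 0) ∧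
    (∃ K : ℝ, ∀ z : ℂ, 0 < z.im → ‖d z‖ ≤ K) ∧ ∃ K : ℝ, ∀ z : ℂ, 0 < z.im → ‖d z * C z‖ ≤ K

theorem HasZeroFreeDenominator.congr {C C' : ℂ → ℂ} (h : HasZeroFreeDenominator C)
    (hCC' : ∀ z : ℂ, 0 < z.im → C' z = C z) : HasZeroFreeDenominator C' := by
  obtain ⟨d, hd, hd0, hdK, K, hK⟩ := h
  exact ⟨d, hd, hd0, hdK, K, fun z hz => by rw [hCC' z hz]; exact hK z hz⟩

theorem HasZeroFreeDenominator.const_mul {C : ℂ → ℂ} (h : HasZeroFreeDenominator C) (c : ℂ) :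
    HasZeroFreeDenominator (fun z => c * C z) := by
  obtain ⟨d, hd, hd0, hdK, K, hK⟩ := h
  refine ⟨d, hd, hd0, hdK, ‖c‖ * K, fun z hz => ?_⟩
  rw [mul_left_comm, norm_mul]
  gcongr
  exact hK z hz

theorem HasZeroFreeDenominator.add {C C' : ℂ → ℂ} (h : HasZeroFreeDenominator C)
    (h' : HasZeroFreeDenominator C') : HasZeroFreeDenominator (fun z => C z + C' z) := by
  obtain ⟨d, hd, hd0, ⟨M, hM⟩, K, hK⟩ := h
  obtain ⟨d', hd', hd0', ⟨M', hM'⟩, K', hK'⟩ := h'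
  refine ⟨fun z => d z * d' z, hd.mul hd', fun z hz => mul_ne_zero (hd0 z hz) (hd0' z hz),
    ⟨M * M', fun z hz => ?_⟩, K * M' + M * K', fun z hz => ?_⟩
  · rw [norm_mul]
    exact mul_le_mul (hM z hz) (hM' z hz) (norm_nonneg _) ((norm_nonneg _).trans (hM z hz))
  · have h1 : d z * d' z * (C z + C' z) = d z * C z * d' z + d z * (d' z * C' z) := by ring
    rw [h1]
    refine (norm_add_le _ _).trans (add_le_add ?_ ?_)
    · rw [norm_mul]
      exact mul_le_mul (hK z hz) (hM' z hz) (norm_nonneg _) ((norm_nonneg _).trans (hK z hz))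
    · rw [norm_mul]
      exact mul_le_mul (hM z hz) (hK' z hz) (norm_nonneg _) ((norm_nonneg _).trans (hM z hz))

theorem hasZeroFreeDenominator_of_im_nonneg {C : ℂ → ℂ} (hC : DifferentiableOn ℂ C {z | 0 < z.im})
    (him : ∀ z : ℂ, 0 < z.im → 0 ≤ (C z).im) : HasZeroFreeDenominator C := by
  have hone : ∀ z : ℂ, 0 < z.im → 1 ≤ ‖C z + Complex.I‖ := fun z hz => by
    have h1 := (le_abs_self _).trans (Complex.abs_im_le_norm (C z + Complex.I))
    rw [Complex.add_im, Complex.I_im] at h1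
    linarith [him z hz]
  have hne : ∀ z : ℂ, 0 < z.im → C z + Complex.I ≠ 0 := fun z hz =>
    norm_pos_iff.mp (one_pos.trans_le (hone z hz))
  have hle : ∀ z : ℂ, 0 < z.im → ‖(C z + Complex.I)⁻¹‖ ≤ 1 := fun z hz => by
    rw [norm_inv]; exact inv_le_one_of_one_le₀ (hone z hz)
  refine ⟨fun z => (C z + Complex.I)⁻¹, (hC.add_const _).inv hne,
    fun z hz => inv_ne_zero (hne z hz), ⟨1, hle⟩, 2, fun z hz => ?_⟩
  have h1 : (C z + Complex.I)⁻¹ * C z = 1 - (C z + Complex.I)⁻¹ * Complex.I := by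
    have := hne z hz
    field_simp
    ring
  rw [h1]
  refine (norm_sub_le _ _).trans ?_
  rw [norm_mul, Complex.norm_I, norm_one]
  linarith [hle z hz]

theorem cauchyTransform_hasZeroFreeDenominator {μ : Measure ℝ} {f : ℝ → ℂ}
    (hf : Integrable f μ) : HasZeroFreeDenominator (cauchyTransform μ f) := by
  have hpos : ∀ p : ℝ → ℝ, (∀ t, 0 ≤ p t) → Integrable p μ →
      HasZeroFreeDenominator (cauchyTransform μ (fun t => (p t : ℂ))) := fun p hp hpi =>
    hasZeroFreeDenominator_of_im_nonneg
      (fun z (hz : 0 < z.im) =>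
        (differentiableAt_cauchyTransform hpi.ofReal hz.ne').differentiableWithinAt)
      (fun z hz => im_cauchyTransform_nonneg hp hpi hz)
  have i1 : Integrable (fun t => ‖f t‖ + (f t).re) μ := hf.norm.add hf.re
  have i2 : Integrable (fun t => ‖f t‖ + (f t).im) μ := hf.norm.add hf.im
  have h1 := hpos (fun t => ‖f t‖ + (f t).re)
    (fun t => by linarith [neg_le_of_abs_le (Complex.abs_re_le_norm (f t))]) i1
  have h2 := hpos (fun t => ‖f t‖ + (f t).im)
    (fun t => by linarith [neg_le_of_abs_le (Complex.abs_im_le_norm (f t))]) i2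
  have h3 := hpos (fun t => ‖f t‖) (fun t => norm_nonneg _) hf.norm
  refine ((h1.add (h2.const_mul Complex.I)).add (h3.const_mul (-(1 + Complex.I)))).congr
    fun z hz => ?_
  simp only [cauchyTransform]
  rw [← integral_const_mul, ← integral_const_mul, ← integral_add, ← integral_add]
  · congr 1
    ext t
    have hft : f t = ((‖f t‖ + (f t).re : ℝ) : ℂ) + Complex.I * ((‖f t‖ + (f t).im : ℝ) : ℂ) +
        -(1 + Complex.I) * (‖f t‖ : ℂ) := by
      push_cast
      linear_combination -Complex.re_add_im (f t)
    refine (congrArg (· / ((t : ℂ) - z)) hft).trans ?_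
    ring
  · exact (integrable_div_ofReal_sub i1.ofReal hz.ne').add
      ((integrable_div_ofReal_sub i2.ofReal hz.ne').const_mul _)
  · exact (integrable_div_ofReal_sub hf.norm.ofReal hz.ne').const_mul _
  · exact integrable_div_ofReal_sub i1.ofReal hz.ne'
  · exact (integrable_div_ofReal_sub i2.ofReal hz.ne').const_mul _

theorem eq_of_eq_on_upperHalf {f g : ℂ → ℂ} (hf : Differentiable ℂ f) (hg : Differentiable ℂ g)
    (h : ∀ z : ℂ, 0 < z.im → f z = g z) : f = g := by
  refine AnalyticOnNhd.eq_of_eventuallyEq (z₀ := Complex.I)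
    (fun z _ => hf.analyticAt z) (fun z _ => hg.analyticAt z) ?_
  filter_upwards [(isOpen_lt continuous_const Complex.continuous_im).mem_nhds
    (show (0 : ℝ) < Complex.I.im by simp)] with z hz using h z hz

/-- The integral of the divided differences `(H w - H t) / (w - t)` against `f μ`. -/
noncomputable def dividedDifferenceTransform (μ : Measure ℝ) (H : ℂ → ℂ) (f : ℝ → ℂ) (w : ℂ) : ℂ :=
  ∫ t, dslope H (t : ℂ) w * f t ∂μ

theorem dslope_comm (f : ℂ → ℂ) (a b : ℂ) : dslope f a b = dslope f b a := by
  rcases eq_or_ne a b with rfl | h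
  · rfl
  · rw [dslope_of_ne _ h, dslope_of_ne _ h.symm, slope_comm]

theorem exists_bound_dslope_of_zero {H : ℂ → ℂ} (hH : Differentiable ℂ H) (w₀ : ℂ) :
    ∃ S : ℝ, ∀ t : ℂ, H t = 0 → ∀ w ∈ Metric.ball w₀ 1, ‖dslope H t w‖ ≤ S := by
  obtain ⟨S, hS⟩ := (isCompact_closedBall w₀ 3).exists_bound_of_continuousOn
    hH.continuous.continuousOn
  have hfar : ∀ t w : ℂ, H t = 0 → w ∈ Metric.closedBall w₀ 3 → 1 ≤ dist w t →
      ‖dslope H t w‖ ≤ S := fun t w ht hw hd => by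
    have hne : w ≠ t := fun h => by rw [h, dist_self] at hd; linarith
    rw [dslope_of_ne _ hne, slope_def_field, ht, sub_zero, norm_div, ← dist_eq_norm]
    exact (div_le_self (norm_nonneg _) hd).trans (hS w hw)
  refine ⟨S, fun t ht w hw => ?_⟩
  rw [Metric.mem_ball] at hw
  rcases le_total 2 (dist t w₀) with h | h
  · refine hfar t w ht (by rw [Metric.mem_closedBall]; linarith) ?_
    linarith [dist_triangle t w w₀, dist_comm t w]
  · refine Complex.norm_le_of_forall_mem_frontier_norm_le (U := Metric.ball w₀ 3)
      Metric.isBounded_ball ?_ (fun z hz => ?_)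
      (subset_closure (Metric.ball_subset_ball (by norm_num : (1 : ℝ) ≤ 3) hw))
    · refine Differentiable.diffContOnCl fun z => ?_
      exact ((Complex.differentiableOn_dslope univ_mem).mpr hH.differentiableOn).differentiableAt
        univ_mem
    · have hz' : dist z w₀ = 3 := by
        rwa [frontier_ball _ (by norm_num)] at hz
      refine hfar t z ht hz'.le ?_
      linarith [dist_triangle z t w₀]

theorem differentiable_dividedDifferenceTransform {μ : Measure ℝ} {H : ℂ → ℂ} {f : ℝ → ℂ}
    (hH : Differentiable ℂ H) (hH0 : ∀ᵐ t : ℝ ∂μ, H t = 0) (hf : Integrable f μ) :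
    Differentiable ℂ (dividedDifferenceTransform μ H f) := by
  intro w₀
  have hds : ∀ a, Differentiable ℂ (dslope H a) := fun a z =>
    ((Complex.differentiableOn_dslope univ_mem).mpr hH.differentiableOn).differentiableAt univ_mem
  obtain ⟨S, hS⟩ := exists_bound_dslope_of_zero hH w₀
  refine differentiableAt_integral_of_locally_dominated one_pos (bound := fun t => S * ‖f t‖)
    (fun w _ => ?_) (Eventually.of_forall fun t => ((hds t).mul_const _).differentiableOn) ?_
    (hf.norm.const_mul S)
  · refine AEStronglyMeasurable.mul (Continuous.aestronglyMeasurable ?_) hf.1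
    simp only [dslope_comm H _ w]
    exact (hds w).continuous.comp Complex.continuous_ofReal
  · filter_upwards [hH0] with t ht w hw
    rw [norm_mul]
    gcongr
    exact hS t ht w hw

theorem dividedDifferenceTransform_eq {μ : Measure ℝ} {H : ℂ → ℂ} {f : ℝ → ℂ}
    (hH0 : ∀ᵐ t : ℝ ∂μ, H t = 0) {w : ℂ} (hw : w.im ≠ 0) :
    dividedDifferenceTransform μ H f w = -(H w * cauchyTransform μ f w) := by
  unfold dividedDifferenceTransform cauchyTransform
  rw [← integral_const_mul, ← integral_neg]
  refine integral_congr_ae ?_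
  filter_upwards [hH0] with t ht
  have hne := ofReal_sub_ne_zero hw t
  rw [dslope_of_ne _ (sub_ne_zero.mp hne).symm, slope_def_field, ht]
  have hne' : w - t ≠ 0 := by rw [← neg_sub]; exact neg_ne_zero.mpr hne
  field_simp
  ring

theorem tendsto_mul_cauchyTransform_vertical {μ : Measure ℝ} {f : ℝ → ℂ} (hf : Integrable f μ)
    (x : ℝ) :
    Tendsto (fun y : ℝ => (y : ℂ) * cauchyTransform μ f (x + y * Complex.I))
      (nhdsWithin 0 (Set.Ioi 0)) (nhds (μ.real {x} • (Complex.I * f x))) := by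
  have hlim : ∫ t, Set.indicator {x} (fun t => Complex.I * f t) t ∂μ =
      μ.real {x} • (Complex.I * f x) := by
    rw [integral_indicator (measurableSet_singleton x), integral_singleton]
  rw [← hlim]
  simp only [cauchyTransform, ← integral_const_mul]
  refine tendsto_integral_filter_of_dominated_convergence (fun t => ‖f t‖)
    (Eventually.of_forall fun y => (aestronglyMeasurable_div_ofReal_sub hf.1 _).const_mul _) ?_
    hf.norm (Eventually.of_forall fun t => ?_)
  · filter_upwards [self_mem_nhdsWithin] with y hy
    have hy' : 0 < y := hy
    refine Eventually.of_forall fun t => ?_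
    have h := norm_div_ofReal_sub_le (w := x + y * Complex.I) (by simpa using hy'.ne') t (f t)
    rw [norm_mul, Complex.norm_real, Real.norm_of_nonneg hy'.le]
    have him : (x + y * Complex.I : ℂ).im = y := by simp
    rw [him, abs_of_pos hy', le_div_iff₀ hy'] at h
    linarith
  · rcases eq_or_ne t x with rfl | htx
    · rw [Set.indicator_of_mem (Set.mem_singleton t)]
      refine Tendsto.congr' ?_ tendsto_const_nhds
      filter_upwards [self_mem_nhdsWithin] with y hy
      have hy' : (y : ℂ) ≠ 0 := by exact_mod_cast (show (0 : ℝ) < y from hy).ne'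
      have hI := Complex.I_ne_zero
      rw [show (t : ℂ) - (t + y * Complex.I) = -(y * Complex.I) by ring]
      field_simp
      rw [Complex.I_sq]
      ring
    · rw [Set.indicator_of_notMem (by simpa using htx)]
      refine Tendsto.mono_left ?_ nhdsWithin_le_nhds
      have hne : (t : ℂ) - x ≠ 0 := sub_ne_zero.mpr (by exact_mod_cast htx)
      have : ContinuousAt (fun y : ℝ => (y : ℂ) * (f t / ((t : ℂ) - (x + y * Complex.I)))) 0 := by
        refine ContinuousAt.mul (by fun_prop) (ContinuousAt.div (by fun_prop) (by fun_prop) ?_)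
        simpa using hne
      simpa using this.tendsto

theorem bounded_type_of_mul_eq {Φ F G H F₁ G₁ C D : ℂ → ℂ} (hΦ : Differentiable ℂ Φ)
    (hF₁ : Differentiable ℂ F₁) (hG₁ : Differentiable ℂ G₁) (hF₁0 : F₁ ≠ 0) (hG₁0 : G₁ ≠ 0)
    (hH : ∀ z, H z = F z - G z) (hF : BddTypeQuot UpperHalf F F₁) (hG : BddTypeQuot UpperHalf G G₁)
    (hCd : DifferentiableOn ℂ C UpperHalf) (hDd : DifferentiableOn ℂ D UpperHalf)
    (hC : HasZeroFreeDenominator C) (hD : HasZeroFreeDenominator D)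
    (hΦF : ∀ z : ℂ, 0 < z.im → Φ z * F₁ z = -(H z * C z))
    (hFG : ∀ z : ℂ, 0 < z.im → F₁ z * D z = G₁ z * C z) :
    ∃ A : ℂ → ℂ, DifferentiableOn ℂ A {z | 0 < z.im} ∧ (¬ ∀ z : ℂ, 0 < z.im → A z = 0) ∧
      ∃ M : ℝ, ∀ z : ℂ, 0 < z.im → ‖A z‖ ≤ M ∧ ‖Φ z * A z‖ ≤ M := by
  have hopen : IsOpen UpperHalf := isOpen_lt continuous_const Complex.continuous_im
  have hconn : IsPreconnected UpperHalf :=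
    (convex_halfSpace_im_gt 0).isPreconnected
  have hzero : ∀ f g : ℂ → ℂ, DifferentiableOn ℂ f UpperHalf → DifferentiableOn ℂ g UpperHalf →
      (∀ z ∈ UpperHalf, f z * g z = 0) → (∀ z ∈ UpperHalf, f z = 0) ∨ ∀ z ∈ UpperHalf, g z = 0 :=
    fun f g hf hg h => AnalyticOnNhd.eq_zero_or_eq_zero_of_mul_eq_zero (hf.analyticOnNhd hopen)
      (hg.analyticOnNhd hopen) h hconn
  have hentire : ∀ f : ℂ → ℂ, Differentiable ℂ f → f ≠ 0 → ¬ ∀ z ∈ UpperHalf, f z = 0 :=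
    fun f hf hf0 h => hf0 (eq_of_eq_on_upperHalf hf (differentiable_const 0) h)
  obtain ⟨p, q, hp, hq, ⟨P, hP⟩, ⟨Q, hQ⟩, hq0, hFpq⟩ := hF
  obtain ⟨p', q', hp', hq', ⟨P', hP'⟩, ⟨Q', hQ'⟩, hq0', hGpq⟩ := hG
  obtain ⟨d, hd, hd0, ⟨S, hS⟩, T, hT⟩ := hC
  obtain ⟨d', hd', hd0', ⟨S', hS'⟩, T', hT'⟩ := hD
  have hmain : ∀ z ∈ UpperHalf, Φ z * (q z * q' z) + p z * q' z * C z - p' z * q z * D z = 0 := by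
    have h := hzero
      (fun z => Φ z * (q z * q' z) + p z * q' z * C z - p' z * q z * D z) (fun z => F₁ z * G₁ z)
      (((hΦ.differentiableOn.mul (hq.mul hq')).add ((hp.mul hq').mul hCd)).sub
        ((hp'.mul hq).mul hDd)) (hF₁.mul hG₁).differentiableOn fun z hz => by
        linear_combination (q z * q' z * G₁ z) * hΦF z hz + (-(p' z * q z * G₁ z)) * hFG z hz
          + (-(q' z * C z * G₁ z)) * hFpq z hz + (q z * C z * G₁ z) * hGpq z hz
          + (-(q z * q' z * C z * G₁ z)) * hH z
    refine h.resolve_right fun h' => ?_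
    rcases hzero F₁ G₁ hF₁.differentiableOn hG₁.differentiableOn h' with h1 | h1
    · exact hentire F₁ hF₁ hF₁0 h1
    · exact hentire G₁ hG₁ hG₁0 h1
  have hmul : ∀ a b : ℂ, ∀ x y : ℝ, ‖a‖ ≤ x → ‖b‖ ≤ y → ‖a * b‖ ≤ x * y := fun a b x y ha hb => by
    rw [norm_mul]; exact mul_le_mul ha hb (norm_nonneg _) ((norm_nonneg _).trans ha)
  refine ⟨fun z => q z * q' z * (d z * d' z), (hq.mul hq').mul (hd.mul hd'), fun h => ?_,
    max (Q * Q' * (S * S')) (P * Q' * (T * S') + P' * Q * (S * T')), fun z hz => ⟨?_, ?_⟩⟩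
  · rcases hzero q q' hq hq' fun z hz => (mul_eq_zero.mp (h z hz)).resolve_right
      (mul_ne_zero (hd0 z hz) (hd0' z hz)) with h1 | h1
    · exact hq0 h1
    · exact hq0' h1
  · exact (hmul _ _ _ _ (hmul _ _ _ _ (hQ z hz) (hQ' z hz))
      (hmul _ _ _ _ (hS z hz) (hS' z hz))).trans (le_max_left _ _)
  · have h1 : Φ z * (q z * q' z * (d z * d' z)) =
        -(p z * q' z * (d z * C z * d' z)) + p' z * q z * (d z * (d' z * D z)) := by
      linear_combination (d z * d' z) * hmain z hz
    rw [h1]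
    refine ((norm_add_le _ _).trans ?_).trans (le_max_right _ _)
    rw [norm_neg]
    exact add_le_add
      (hmul _ _ _ _ (hmul _ _ _ _ (hP z hz) (hQ' z hz)) (hmul _ _ _ _ (hT z hz) (hS' z hz)))
      (hmul _ _ _ _ (hmul _ _ _ _ (hP' z hz) (hQ z hz)) (hmul _ _ _ _ (hS z hz) (hT' z hz)))

theorem BddTypeQuot.reflect {F G : ℂ → ℂ} (h : BddTypeQuot LowerHalf F G) :
    BddTypeQuot UpperHalf (fun z => (starRingEnd ℂ) (F ((starRingEnd ℂ) z)))
      (fun z => (starRingEnd ℂ) (G ((starRingEnd ℂ) z))) := by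
  obtain ⟨p, q, hp, hq, ⟨P, hP⟩, ⟨Q, hQ⟩, hq0, hpq⟩ := h
  have hmem : ∀ z ∈ UpperHalf, (starRingEnd ℂ) z ∈ LowerHalf := fun z hz => by
    have hz' : 0 < z.im := hz
    show ((starRingEnd ℂ) z).im < 0
    simpa using hz'
  have hd : ∀ f : ℂ → ℂ, DifferentiableOn ℂ f LowerHalf →
      DifferentiableOn ℂ (fun z => (starRingEnd ℂ) (f ((starRingEnd ℂ) z))) UpperHalf :=
    fun f hf z hz => by
      have := (hf.differentiableAt ((isOpen_lt Complex.continuous_im continuous_const).mem_nhds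
        (hmem z hz))).conj_conj
      rw [Complex.conj_conj] at this
      exact this.differentiableWithinAt
  refine ⟨fun z => (starRingEnd ℂ) (p ((starRingEnd ℂ) z)),
    fun z => (starRingEnd ℂ) (q ((starRingEnd ℂ) z)), hd p hp, hd q hq,
    ⟨P, fun z hz => ?_⟩, ⟨Q, fun z hz => ?_⟩, fun h => hq0 fun z hz => ?_, fun z hz => ?_⟩
  · rw [RCLike.norm_conj]; exact hP _ (hmem z hz)
  · rw [RCLike.norm_conj]; exact hQ _ (hmem z hz)
  · have hz' : z.im < 0 := hz
    have := h ((starRingEnd ℂ) z) (show 0 < ((starRingEnd ℂ) z).im by simpa using hz')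
    simpa using this
  · rw [← map_mul, ← map_mul, hpq _ (hmem z hz)]

theorem IsAlgebraicDeBranges.exists_apply_ne_zero {L : Submodule ℂ (ℂ → ℂ)}
    (hdb : IsAlgebraicDeBranges L) {F : ℂ → ℂ} (hF : F ∈ L) (hF0 : F ≠ 0) (w : ℂ) :
    ∃ G ∈ L, G w ≠ 0 := by
  have key : ∀ n : ℕ, ∀ F ∈ L, analyticOrderAt F w = n → ∃ G ∈ L, G w ≠ 0 := by
    intro n
    induction n with
    | zero =>
      intro F hF hn
      exact ⟨F, hF, ((hdb.1 F hF).analyticAt w).analyticOrderAt_eq_zero.mp (by simpa using hn)⟩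
    | succ n ih =>
      intro F hF hn
      have hFw : F w = 0 := by
        by_contra h
        rw [((hdb.1 F hF).analyticAt w).analyticOrderAt_eq_zero.mpr h] at hn
        exact absurd hn (by exact_mod_cast (Nat.succ_ne_zero n).symm)
      obtain ⟨G, hG, hGF⟩ := hdb.2.1 F hF w hFw
      refine ih G hG ?_
      have hfac : F = (fun z => z - w) * G := by
        ext z
        rw [Pi.mul_apply]
        rcases eq_or_ne z w with rfl | hz
        · simp [hFw]
        · rw [hGF z hz, mul_div_cancel₀ _ (sub_ne_zero.mpr hz)]
      have hid : analyticOrderAt (fun z : ℂ => z - w) w = 1 := by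
        have : AnalyticAt ℂ (fun z : ℂ => z - w) w := by fun_prop
        rw [← Nat.cast_one, this.analyticOrderAt_eq_natCast]
        exact ⟨fun _ => 1, analyticAt_const, one_ne_zero, by simp⟩
      rw [hfac, analyticOrderAt_mul (by fun_prop) ((hdb.1 G hG).analyticAt w), hid] at hn
      have h1 : (1 : ℕ∞) + analyticOrderAt G w = 1 + n := by rw [hn]; push_cast; ring
      exact (ENat.add_right_injective_of_ne_top ENat.one_ne_top) h1
  have hne : analyticOrderAt F w ≠ ⊤ := fun h => hF0 <|
    AnalyticOnNhd.eq_of_eventuallyEq (fun z _ => (hdb.1 F hF).analyticAt z)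
      (fun z _ => analyticAt_const) (analyticOrderAt_eq_top.mp h)
  obtain ⟨n, hn⟩ := ENat.ne_top_iff_exists.mp hne
  exact key n F hF hn.symm

theorem IsAlgebraicDeBranges.exists_div_sub {L : Submodule ℂ (ℂ → ℂ)}
    (hdb : IsAlgebraicDeBranges L) {F G : ℂ → ℂ} (hF : F ∈ L) (hG : G ∈ L) (w : ℂ) :
    ∃ Q ∈ L, ∀ z, z ≠ w → Q z = (G w * F z - F w * G z) / (z - w) := by
  obtain ⟨Q, hQ, h⟩ := hdb.2.1 (G w • F - F w • G)
    (L.sub_mem (L.smul_mem _ hF) (L.smul_mem _ hG)) w (by simp; ring)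
  exact ⟨Q, hQ, fun z hz => by simpa using h z hz⟩

theorem IsAlgebraicDeBranges.mul_cauchyTransform_comm {μ : Measure ℝ} {L : Submodule ℂ (ℂ → ℂ)}
    {g₀ : ℝ → ℂ} (hdb : IsAlgebraicDeBranges L)
    (hL : ∀ F ∈ L, Integrable (fun t : ℝ => F t * g₀ t) μ)
    (hann : ∀ F ∈ L, ∫ t : ℝ, F t * g₀ t ∂μ = 0) {F G : ℂ → ℂ} (hF : F ∈ L) (hG : G ∈ L) {w : ℂ}
    (hw : w.im ≠ 0) :
    G w * cauchyTransform μ (fun t => F t * g₀ t) w =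
      F w * cauchyTransform μ (fun t => G t * g₀ t) w := by
  obtain ⟨Q, hQ, hQe⟩ := hdb.exists_div_sub hF hG w
  rw [← sub_eq_zero, ← hann Q hQ]
  unfold cauchyTransform
  rw [← integral_const_mul, ← integral_const_mul, ← integral_sub
    ((integrable_div_ofReal_sub (hL F hF) hw).const_mul _)
    ((integrable_div_ofReal_sub (hL G hG) hw).const_mul _)]
  congr 1
  ext t
  rw [hQe t (sub_ne_zero.mp (ofReal_sub_ne_zero hw t))]
  ring

theorem L1Majorant_mul_norm_cauchyTransform_le {μ : Measure ℝ} {L : Submodule ℂ (ℂ → ℂ)}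
    {g₀ : ℝ → ℂ} (hdb : IsAlgebraicDeBranges L) (hg₀u : ∀ᵐ x ∂μ, ‖g₀ x‖ = 1)
    (hL : ∀ F ∈ L, Integrable (fun t : ℝ => F t * g₀ t) μ)
    (hann : ∀ F ∈ L, ∫ t : ℝ, F t * g₀ t ∂μ = 0) {G : ℂ → ℂ} (hG : G ∈ L) {w : ℂ}
    (hw : w.im ≠ 0) :
    L1Majorant μ L w * ‖cauchyTransform μ (fun t => G t * g₀ t) w‖ₑ ≤
      ENNReal.ofReal (‖G w‖ / |w.im|) := by
  unfold L1Majorant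
  rw [ENNReal.iSup_mul]
  refine iSup_le fun ⟨F, hF, hF1⟩ => ?_
  have hint : ∫ t : ℝ, ‖F t * g₀ t‖ ∂μ ≤ 1 := by
    rw [integral_norm_eq_lintegral_enorm (hL F hF).1]
    refine ENNReal.toReal_le_of_le_ofReal zero_le_one ?_
    rw [ENNReal.ofReal_one]
    refine le_of_eq_of_le (lintegral_congr_ae ?_) hF1
    filter_upwards [hg₀u] with t ht
    rw [← enorm_eq_nnnorm, ← ofReal_norm, ← ofReal_norm, norm_mul, ht, mul_one]
  have hle : ‖F w‖ * ‖cauchyTransform μ (fun t => G t * g₀ t) w‖ ≤ ‖G w‖ / |w.im| := by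
    rw [← norm_mul, ← hdb.mul_cauchyTransform_comm hL hann hF hG hw, norm_mul, div_eq_mul_one_div]
    gcongr
    refine (norm_cauchyTransform_le (hL F hF) hw).trans ?_
    have := abs_pos.mpr hw
    gcongr
  change ‖F w‖ₑ * _ ≤ _
  rw [← enorm_mul, ← ofReal_norm, norm_mul]
  exact ENNReal.ofReal_le_ofReal hle

theorem exists_entire_quotient {μ : Measure ℝ} {L : Submodule ℂ (ℂ → ℂ)} {g₀ : ℝ → ℂ}
    (hdb : IsAlgebraicDeBranges L) (hL : ∀ F ∈ L, Integrable (fun t : ℝ => F t * g₀ t) μ)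
    (hann : ∀ F ∈ L, ∫ t : ℝ, F t * g₀ t ∂μ = 0) {F₀ : ℂ → ℂ} (hF₀ : F₀ ∈ L) (hF₀0 : F₀ ≠ 0)
    {H : ℂ → ℂ} (hH : Differentiable ℂ H) (hH0 : ∀ᵐ t : ℝ ∂μ, H t = 0) :
    ∃ Φ : ℂ → ℂ, Differentiable ℂ Φ ∧ ∀ G ∈ L, ∀ w : ℂ, w.im ≠ 0 →
      Φ w * G w = -(H w * cauchyTransform μ (fun t => G t * g₀ t) w) := by
  let E : (ℂ → ℂ) → ℂ → ℂ := fun G => dividedDifferenceTransform μ H (fun t => G t * g₀ t)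
  have hE : ∀ G ∈ L, Differentiable ℂ (E G) := fun G hG =>
    differentiable_dividedDifferenceTransform hH hH0 (hL G hG)
  have hcomm : ∀ F ∈ L, ∀ G ∈ L, ∀ w, E F w * G w = E G w * F w := fun F hF G hG => by
    refine congrFun (eq_of_eq_on_upperHalf (f := fun w => E F w * G w) (g := fun w => E G w * F w)
      ((hE F hF).mul (hdb.1 G hG)) ((hE G hG).mul (hdb.1 F hF)) fun z hz => ?_)
    simp only [E]
    rw [dividedDifferenceTransform_eq hH0 hz.ne', dividedDifferenceTransform_eq hH0 hz.ne']
    linear_combination (-(H z)) * hdb.mul_cauchyTransform_comm hL hann hF hG hz.ne'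
  choose S hSL hS0 using fun w => hdb.exists_apply_ne_zero hF₀ hF₀0 w
  have hΦ : ∀ G ∈ L, ∀ w, E (S w) w / S w w * G w = E G w := fun G hG w => by
    rw [div_mul_eq_mul_div, hcomm _ (hSL w) G hG, mul_div_cancel_right₀ _ (hS0 w)]
  refine ⟨fun w => E (S w) w / S w w, fun w => ?_, fun G hG w hw => ?_⟩
  · have hd : DifferentiableAt ℂ (fun z => E (S w) z / S w z) w :=
      (hE _ (hSL w) w).div (hdb.1 _ (hSL w) w) (hS0 w)
    refine hd.congr_of_eventuallyEq ?_
    filter_upwards [(hdb.1 _ (hSL w)).continuous.continuousAt.eventually_ne (hS0 w)] with z hz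
    rw [eq_div_iff hz]
    exact hΦ _ (hSL w) z
  · rw [hΦ G hG w]
    exact dividedDifferenceTransform_eq hH0 hw

theorem norm_entire_quotient_le {μ : Measure ℝ} {L : Submodule ℂ (ℂ → ℂ)} {g₀ : ℝ → ℂ}
    (hdb : IsAlgebraicDeBranges L) (hg₀u : ∀ᵐ x ∂μ, ‖g₀ x‖ = 1)
    (hL : ∀ F ∈ L, Integrable (fun t : ℝ => F t * g₀ t) μ)
    (hann : ∀ F ∈ L, ∫ t : ℝ, F t * g₀ t ∂μ = 0) {F₀ : ℂ → ℂ} (hF₀ : F₀ ∈ L) (hF₀0 : F₀ ≠ 0)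
    {H Φ : ℂ → ℂ} (hΦ : ∀ G ∈ L, ∀ w : ℂ, w.im ≠ 0 →
      Φ w * G w = -(H w * cauchyTransform μ (fun t => G t * g₀ t) w))
    {K : ℝ≥0} {w : ℂ} (hw : w.im ≠ 0) (hK : ‖H w‖ₑ ≤ K * L1Majorant μ L w) :
    ‖Φ w‖ ≤ K / |w.im| := by
  obtain ⟨G, hG, hGw⟩ := hdb.exists_apply_ne_zero hF₀ hF₀0 w
  have h1 := congrArg (fun z => ‖z‖ₑ) (hΦ G hG w hw)
  simp only [enorm_neg, enorm_mul] at h1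
  have h2 : ‖Φ w‖ₑ * ‖G w‖ₑ ≤ ENNReal.ofReal (K * (‖G w‖ / |w.im|)) := by
    rw [h1, ENNReal.ofReal_mul K.coe_nonneg, ENNReal.ofReal_coe_nnreal]
    calc _ ≤ K * L1Majorant μ L w * ‖cauchyTransform μ (fun t => G t * g₀ t) w‖ₑ := by gcongr
      _ ≤ _ := by
        rw [mul_assoc]
        gcongr
        exact L1Majorant_mul_norm_cauchyTransform_le hdb hg₀u hL hann hG hw
  rw [← enorm_mul, ← ofReal_norm, ENNReal.ofReal_le_ofReal_iff (by positivity), norm_mul] at h2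
  refine le_of_mul_le_mul_right (h2.trans (le_of_eq ?_)) (norm_pos_iff.mpr hGw)
  ring

theorem exists_bound_of_eventually_bound {f : ℝ → ℂ} (hf : Continuous f) {K : ℝ} (hK0 : 0 ≤ K)
    (hK : ∀ᶠ y in atTop ⊔ atBot, ‖f y‖ ≤ K / |y|) : ∃ M : ℝ, ∀ y, ‖f y‖ ≤ M := by
  obtain ⟨a, ha⟩ := eventually_atTop.mp (eventually_sup.mp hK).1
  obtain ⟨b, hb⟩ := eventually_atBot.mp (eventually_sup.mp hK).2
  obtain ⟨C, hC⟩ := (isCompact_Icc (a := min b (-1)) (b := max a 1)).exists_bound_of_continuousOn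
    hf.continuousOn
  have hfar : ∀ y : ℝ, 1 ≤ |y| → K / |y| ≤ max C K := fun y hy =>
    (div_le_self hK0 hy).trans (le_max_right _ _)
  refine ⟨max C K, fun y => ?_⟩
  rcases le_total (max a 1) y with h | h
  · exact (ha y ((le_max_left _ _).trans h)).trans
      (hfar y (((le_max_right _ _).trans h).trans (le_abs_self y)))
  rcases le_total y (min b (-1)) with h' | h'
  · refine (hb y (h'.trans (min_le_left _ _))).trans (hfar y ?_)
    have := h'.trans (min_le_right _ _)
    exact (by linarith : 1 ≤ -y).trans (neg_le_abs y)
  · exact (hC y ⟨h', h⟩).trans (le_max_left _ _)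

theorem eq_zero_of_bounded_type_of_imaginary_decay {Φ A B : ℂ → ℂ} {M N K : ℝ}
    (hΦ : Differentiable ℂ Φ)
    (hA : DifferentiableOn ℂ A {z | 0 < z.im}) (hA0 : ¬ ∀ z : ℂ, 0 < z.im → A z = 0)
    (hAM : ∀ z : ℂ, 0 < z.im → ‖A z‖ ≤ M ∧ ‖Φ z * A z‖ ≤ M)
    (hB : DifferentiableOn ℂ B {z | 0 < z.im}) (hB0 : ¬ ∀ z : ℂ, 0 < z.im → B z = 0)
    (hBN : ∀ z : ℂ, 0 < z.im → ‖B z‖ ≤ N ∧ ‖Φ ((starRingEnd ℂ) z) * B z‖ ≤ N)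
    (hK0 : 0 ≤ K) (hK : ∀ᶠ y : ℝ in atTop ⊔ atBot, ‖Φ (y * Complex.I)‖ ≤ K / |y|) (z : ℂ) :
    Φ z = 0 := by
  have hcont : Continuous fun y : ℝ => Φ (y * Complex.I) := hΦ.continuous.comp (by fun_prop)
  obtain ⟨C, hC⟩ := exists_bound_of_eventually_bound hcont hK0 hK
  have hopen : IsOpen {z : ℂ | 0 < z.im} := isOpen_lt continuous_const Complex.continuous_im
  have hAB0 : ¬ ∀ z : ℂ, 0 < z.im → A z * B z = 0 := fun h =>
    (AnalyticOnNhd.eq_zero_or_eq_zero_of_mul_eq_zero (hA.analyticOnNhd hopen)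
      (hB.analyticOnNhd hopen) h (convex_halfSpace_im_gt 0).isPreconnected).elim hA0 hB0
  have hmul : ∀ a b : ℂ, ‖a‖ ≤ M → ‖b‖ ≤ N → ‖a * b‖ ≤ M * N := fun a b ha hb => by
    rw [norm_mul]; exact mul_le_mul ha hb (norm_nonneg _) ((norm_nonneg _).trans ha)
  have hconst := apply_eq_of_bounded_on_imaginary_axis hΦ
    (fun ε hε => exp_type_zero_of_bounded_type (A := fun z => A z * B z) (M := M * N) (M' := M * N)
      hΦ (hA.mul hB) hAB0 (fun z hz => hmul _ _ (hAM z hz).1 (hBN z hz).1)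
      (fun z hz => by rw [← mul_assoc]; exact hmul _ _ (hAM z hz).2 (hBN z hz).1)
      (fun z hz => by rw [mul_left_comm]; exact hmul _ _ (hAM z hz).1 (hBN z hz).2) hC hε) hC
  have hlim : Tendsto (fun y : ℝ => K / |y|) atTop (nhds 0) :=
    tendsto_const_nhds.div_atTop tendsto_abs_atTop_atTop
  refine norm_le_zero_iff.mp (ge_of_tendsto hlim ?_)
  filter_upwards [(eventually_sup.mp hK).1] with y hy
  rwa [hconst z (y * Complex.I)]

theorem eq_zero_of_entire_quotient {μ : Measure ℝ} {L : Submodule ℂ (ℂ → ℂ)} {g₀ : ℝ → ℂ}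
    (hdb : IsAlgebraicDeBranges L) (hg₀u : ∀ᵐ x ∂μ, ‖g₀ x‖ = 1)
    (hL : ∀ F ∈ L, Integrable (fun t : ℝ => F t * g₀ t) μ)
    (hann : ∀ F ∈ L, ∫ t : ℝ, F t * g₀ t ∂μ = 0) {F G Φ : ℂ → ℂ} (hF : MemKcal μ L F)
    (hG : MemKcal μ L G) (hΦd : Differentiable ℂ Φ) (hΦ : ∀ U ∈ L, ∀ w : ℂ, w.im ≠ 0 →
      Φ w * U w = -((F w - G w) * cauchyTransform μ (fun t => U t * g₀ t) w)) (z : ℂ) :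
    Φ z = 0 := by
  obtain ⟨-, -, ⟨a, ha⟩, F₁, hF₁, hF₁0, hFu, hFl⟩ := hF
  obtain ⟨-, -, ⟨b, hb⟩, G₁, hG₁, hG₁0, hGu, hGl⟩ := hG
  have hK : ∀ᶠ y : ℝ in atTop ⊔ atBot, ‖Φ (y * Complex.I)‖ ≤ (a + b : ℝ≥0) / |y| := by
    have hne : ∀ᶠ y : ℝ in atTop ⊔ atBot, y ≠ 0 :=
      eventually_sup.mpr ⟨eventually_ne_atTop 0, eventually_ne_atBot 0⟩
    filter_upwards [ha, hb, hne] with y hay hby hy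
    have him : (y * Complex.I : ℂ).im = y := by simp
    have h := norm_entire_quotient_le (H := fun w => F w - G w) (K := a + b) (w := y * Complex.I)
      hdb hg₀u hL hann hF₁ hF₁0 hΦ (by rwa [him]) (by
        refine (enorm_sub_le).trans ?_
        rw [ENNReal.coe_add, add_mul]
        exact add_le_add hay hby)
    rwa [him] at h
  have hCd : ∀ f : ℝ → ℂ, Integrable f μ → DifferentiableOn ℂ (cauchyTransform μ f) UpperHalf :=
    fun f hf z (hz : 0 < z.im) =>
      (differentiableAt_cauchyTransform hf hz.ne').differentiableWithinAt
  obtain ⟨A, hA, hA0, M, hM⟩ := bounded_type_of_mul_eq (H := fun z => F z - G z) hΦd (hdb.1 _ hF₁)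
    (hdb.1 _ hG₁) hF₁0 hG₁0 (fun _ => rfl) hFu hGu (hCd _ (hL _ hF₁)) (hCd _ (hL _ hG₁))
    (cauchyTransform_hasZeroFreeDenominator (hL _ hF₁))
    (cauchyTransform_hasZeroFreeDenominator (hL _ hG₁))
    (fun z hz => hΦ _ hF₁ z hz.ne')
    (fun z hz => hdb.mul_cauchyTransform_comm hL hann hG₁ hF₁ hz.ne')
  have hsharp : ∀ f : ℂ → ℂ, Differentiable ℂ f →
      Differentiable ℂ (fun z => (starRingEnd ℂ) (f ((starRingEnd ℂ) z))) := fun f hf z => by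
    have := (hf ((starRingEnd ℂ) z)).conj_conj
    rwa [Complex.conj_conj] at this
  have hsharp0 : ∀ f : ℂ → ℂ, f ≠ 0 → (fun z => (starRingEnd ℂ) (f ((starRingEnd ℂ) z))) ≠ 0 :=
    fun f hf h => hf <| funext fun z => by simpa using congrFun h ((starRingEnd ℂ) z)
  have hconjL : ∀ U ∈ L, Integrable (fun t : ℝ => (starRingEnd ℂ) (U t * g₀ t)) μ := fun U hU =>
    (Complex.conjLIE.integrable_comp_iff).mpr (hL U hU)
  have himc : ∀ z : ℂ, 0 < z.im → ((starRingEnd ℂ) z).im ≠ 0 := fun z hz => by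
    simpa using hz.ne'
  obtain ⟨B, hB, hB0, N, hN⟩ := bounded_type_of_mul_eq
    (H := fun z => (starRingEnd ℂ) (F ((starRingEnd ℂ) z) - G ((starRingEnd ℂ) z)))
    (hsharp _ hΦd) (hsharp _ (hdb.1 _ hF₁))
    (hsharp _ (hdb.1 _ hG₁)) (hsharp0 _ hF₁0) (hsharp0 _ hG₁0) (fun _ => map_sub _ _ _)
    hFl.reflect hGl.reflect (hCd _ (hconjL _ hF₁)) (hCd _ (hconjL _ hG₁))
    (cauchyTransform_hasZeroFreeDenominator (hconjL _ hF₁))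
    (cauchyTransform_hasZeroFreeDenominator (hconjL _ hG₁))
    (fun z hz => by
      rw [cauchyTransform_conj, ← map_mul, hΦ _ hF₁ _ (himc z hz), map_neg, map_mul])
    (fun z hz => by
      rw [cauchyTransform_conj, cauchyTransform_conj, ← map_mul, ← map_mul,
        hdb.mul_cauchyTransform_comm hL hann hG₁ hF₁ (himc z hz)])
  refine eq_zero_of_bounded_type_of_imaginary_decay hΦd hA hA0 hM hB hB0 (N := N)
    (fun z hz => ⟨(hN z hz).1, ?_⟩) (a + b).coe_nonneg hK z
  have := (hN z hz).2
  rw [norm_mul, RCLike.norm_conj] at this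
  rwa [norm_mul]

theorem ae_eq_zero_of_cauchyTransform_mul_eq_zero {μ : Measure ℝ} [IsLocallyFiniteMeasure μ]
    (hdisc : IsDiscreteMeasure μ) {f : ℝ → ℂ} (hf : Integrable f μ) {H : ℂ → ℂ}
    (hH : Differentiable ℂ H) (hH0 : H ≠ 0)
    (h : ∀ w : ℂ, w.im ≠ 0 → H w * cauchyTransform μ f w = 0) : ∀ᵐ x ∂μ, f x = 0 := by
  have hatom : ∀ x, μ {x} ≠ 0 → f x = 0 := by
    intro x hx
    have hne : ∀ᶠ z in nhdsWithin (x : ℂ) {(x : ℂ)}ᶜ, H z ≠ 0 := by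
      refine (hH.analyticAt x).eventually_eq_zero_or_eventually_ne_zero.resolve_left fun h0 => ?_
      exact hH0 (AnalyticOnNhd.eq_of_eventuallyEq (fun z _ => hH.analyticAt z)
        (fun z _ => analyticAt_const) h0)
    have hpath : Tendsto (fun y : ℝ => (x : ℂ) + y * Complex.I) (nhdsWithin 0 (Set.Ioi 0))
        (nhdsWithin (x : ℂ) {(x : ℂ)}ᶜ) := by
      refine tendsto_nhdsWithin_iff.mpr ⟨?_, ?_⟩
      · exact (Continuous.tendsto' (by fun_prop) _ _ (by simp)).mono_left nhdsWithin_le_nhds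
      · filter_upwards [self_mem_nhdsWithin] with y hy
        have hy' : y ≠ 0 := (show (0 : ℝ) < y from hy).ne'
        simpa using hy'
    have hzero : Tendsto (fun y : ℝ => (y : ℂ) * cauchyTransform μ f (x + y * Complex.I))
        (nhdsWithin 0 (Set.Ioi 0)) (nhds 0) := by
      refine Tendsto.congr' ?_ tendsto_const_nhds
      filter_upwards [hpath.eventually hne, self_mem_nhdsWithin] with y hHy hy
      have hy' : y ≠ 0 := (show (0 : ℝ) < y from hy).ne'
      rw [(mul_eq_zero.mp (h _ (by simpa using hy'))).resolve_left hHy, mul_zero]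
    have hlim := tendsto_nhds_unique (tendsto_mul_cauchyTransform_vertical hf x) hzero
    have hreal : μ.real {x} ≠ 0 :=
      ENNReal.toReal_ne_zero.mpr ⟨hx, isCompact_singleton.measure_lt_top.ne⟩
    simpa [hreal] using hlim
  obtain ⟨s, hs, hsμ⟩ := hdisc
  have hsub : {x | f x = 0}ᶜ ⊆ sᶜ ∪ ⋃ x ∈ s ∩ {x | f x ≠ 0}, {x} := by
    intro x hx
    by_cases hxs : x ∈ s
    · exact Or.inr (Set.mem_biUnion (show x ∈ s ∩ {x | f x ≠ 0} from ⟨hxs, hx⟩) rfl)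
    · exact Or.inl hxs
  refine measure_mono_null hsub (measure_union_null hsμ ?_)
  refine (measure_biUnion_null_iff (hs.mono Set.inter_subset_left)).mpr fun x hx => ?_
  by_contra hx0
  exact hx.2 (hatom x hx0)

/-- The restriction map `F ↦ F|_ℝ` is injective on `𝒦`. -/
theorem stmt15 (μ : MeasureTheory.Measure ℝ) [MeasureTheory.IsLocallyFiniteMeasure μ]
    (hdisc : IsDiscreteMeasure μ)
    (hsupp : ∃ a b : ℝ, a ≠ b ∧ MemSupport μ a ∧ MemSupport μ b)
    (L : Submodule ℂ (ℂ → ℂ)) (hdb : IsAlgebraicDeBranges L)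
    (hint : ∀ F ∈ L, (∫⁻ x : ℝ, (‖F (x : ℂ)‖₊ : ℝ≥0∞) ∂μ) < ⊤)
    (hinj : ∀ F ∈ L, ∀ G ∈ L, (fun x : ℝ => F (x : ℂ)) =ᵐ[μ] (fun x : ℝ => G (x : ℂ)) → F = G)
    (g₀ : ℝ → ℂ) (hg₀m : Measurable g₀) (hg₀u : ∀ᵐ x ∂μ, ‖g₀ x‖ = 1)
    (hclos : ∀ f : ℝ → ℂ, MeasureTheory.Integrable f μ →
      ((∀ ε : ℝ, 0 < ε → ∃ F ∈ L,
          (∫⁻ x : ℝ, (‖f x - F (x : ℂ)‖₊ : ℝ≥0∞) ∂μ) < ENNReal.ofReal ε) ↔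
        ∫ x, f x * g₀ x ∂μ = 0)) :
    ∀ F G : ℂ → ℂ, MemKcal μ L F → MemKcal μ L G →
      (fun x : ℝ => F (x : ℂ)) =ᵐ[μ] (fun x : ℝ => G (x : ℂ)) → F = G := by
  intro F G hF hG hFG
  have hrestr : ∀ U ∈ L, Integrable (fun t : ℝ => U t) μ := fun U hU =>
    ⟨((hdb.1 U hU).continuous.comp Complex.continuous_ofReal).aestronglyMeasurable, hint U hU⟩
  have hL : ∀ U ∈ L, Integrable (fun t : ℝ => U t * g₀ t) μ := fun U hU =>
    (hrestr U hU).mul_bdd (c := 1) hg₀m.aestronglyMeasurable (hg₀u.mono fun t ht => ht.le)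
  have hann : ∀ U ∈ L, ∫ t : ℝ, U t * g₀ t ∂μ = 0 := fun U hU =>
    (hclos _ (hrestr U hU)).mp fun ε hε => ⟨U, hU, by simpa using hε⟩
  have hd : Differentiable ℂ fun z => F z - G z := hF.1.sub hG.1
  obtain ⟨-, -, -, F₁, hF₁, hF₁0, -⟩ := id hF
  obtain ⟨Φ, hΦd, hΦ⟩ := exists_entire_quotient hdb hL hann hF₁ hF₁0 hd
    (hFG.mono fun t ht => sub_eq_zero.mpr ht)
  by_contra hne
  have hH0 : (fun z => F z - G z) ≠ 0 := fun h =>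
    hne (funext fun z => sub_eq_zero.mp (congrFun h z))
  have hae := ae_eq_zero_of_cauchyTransform_mul_eq_zero hdisc (hL _ hF₁) hd hH0 fun w hw => by
    have := hΦ _ hF₁ w hw
    rw [eq_zero_of_entire_quotient hdb hg₀u hL hann hF hG hΦd hΦ w, zero_mul] at this
    exact neg_eq_zero.mp this.symm
  refine hF₁0 (hinj _ hF₁ 0 L.zero_mem ?_)
  filter_upwards [hae, hg₀u] with t ht hgt
  refine (mul_eq_zero.mp ht).resolve_right fun h0 => ?_
  rw [h0, norm_zero] at hgt
  exact zero_ne_one hgt
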